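/- arXiv:2101.08217 — 2 statements merged into one kernel-verified Lean document; each statement's English description precedes it below -/
import Mathlib

section
/- Let f be a nonzero homogeneous polynomial of degree 3 in four variables over ℚ defining a smooth cubic surface V(f). If no three lines on V(f) defined over ℚ form a skew triple (i.e., among any three ℚ-lines, at least two intersect), then the number of lines on V(f) defined over ℚ is 0, 1, 2, 3, or 5. -/
open MvPolynomial

/-- The restriction of `f` to the line spanned by `v` and `w`:
the polynomial `f (s • v + t • w)` in the two variables `s, t`. -/
noncomputable def lineRestrict {k : Type*} [CommRing k] (f : MvPolynomial (Fin 4) k)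
    (v w : Fin 4 → k) : MvPolynomial (Fin 2) k :=
  aeval (fun i => C (v i) * X 0 + C (w i) * X 1) f

/-- `W` is a line on the cubic surface `V(f)` defined over `k`: a 2-dimensional
`k`-linear subspace of `k⁴` on which `f` vanishes identically as a polynomial. -/
def IsLineOn {k : Type*} [Field k] (f : MvPolynomial (Fin 4) k)
    (W : Submodule k (Fin 4 → k)) : Prop :=
  Module.finrank k W = 2 ∧
    ∃ v w : Fin 4 → k, Submodule.span k {v, w} = W ∧ lineRestrict f v w = 0

/-- `f` defines a smooth cubic surface over `k`: `f` is a nonzero homogeneous cubic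
and, over an algebraic closure, the only common zero of `f` and its partial
derivatives is the origin. -/
def IsSmoothCubic (k : Type*) [Field k] (f : MvPolynomial (Fin 4) k) : Prop :=
  f ≠ 0 ∧ f.IsHomogeneous 3 ∧
    ∀ x : Fin 4 → AlgebraicClosure k,
      (eval x (map (algebraMap k (AlgebraicClosure k)) f) = 0 ∧
        ∀ i : Fin 4, eval x (map (algebraMap k (AlgebraicClosure k)) (pderiv i f)) = 0) →
      x = 0

/-- The linear form attached to a functional on `k⁴`. -/
noncomputable def linForm {k : Type*} [CommRing k] (m : Module.Dual k (Fin 4 → k)) :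
    MvPolynomial (Fin 4) k :=
  ∑ i, C (m (Pi.single i 1)) * X i

section LinForm

variable {k : Type*} [CommRing k]

lemma isHomogeneous_linForm (m : Module.Dual k (Fin 4 → k)) : (linForm m).IsHomogeneous 1 :=
  IsHomogeneous.sum _ _ _ fun _ _ => isHomogeneous_C_mul_X _ _

lemma eval_linForm (m : Module.Dual k (Fin 4 → k)) (x : Fin 4 → k) :
    eval x (linForm m) = m x := by
  rw [linForm, map_sum, LinearMap.pi_apply_eq_sum_univ m x]
  refine Finset.sum_congr rfl fun i _ => ?_
  rw [map_mul, eval_C, eval_X, smul_eq_mul, mul_comm]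
  congr 2
  ext j
  simp [Pi.single_apply, eq_comm]

lemma eval_map_linForm {K : Type*} [Field K] [Algebra k K] (m : Module.Dual k (Fin 4 → k))
    {u v : Fin 4 → k} (hu : m u = 0) (hv : m v = 0) (s t : K) :
    eval (fun i => s * algebraMap k K (u i) + t * algebraMap k K (v i))
      (map (algebraMap k K) (linForm m)) = 0 := by
  have key (w : Fin 4 → k) : ∑ i, algebraMap k K (m (Pi.single i 1)) * algebraMap k K (w i) =
      algebraMap k K (m w) := by
    rw [← eval_linForm m w, linForm]
    simp
  have h : s * ∑ i, algebraMap k K (m (Pi.single i 1)) * algebraMap k K (u i) +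
      t * ∑ i, algebraMap k K (m (Pi.single i 1)) * algebraMap k K (v i) = 0 := by
    rw [key, key, hu, hv]; simp
  rw [← h, linForm, Finset.mul_sum, Finset.mul_sum, ← Finset.sum_add_distrib]
  simp only [map_sum, map_mul, map_C, map_X, eval_C, eval_X]
  exact Finset.sum_congr rfl fun i _ => by ring

lemma exists_linForm_eq {p : MvPolynomial (Fin 4) k} (hp : p.IsHomogeneous 1) :
    ∃ m, linForm m = p := by
  rw [← mem_homogeneousSubmodule, homogeneousSubmodule_one_eq_span_X,
    Submodule.mem_span_range_iff_exists_fun] at hp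
  obtain ⟨c, rfl⟩ := hp
  refine ⟨∑ i, c i • LinearMap.proj i, Finset.sum_congr rfl fun i _ => ?_⟩
  rw [← C_mul']
  simp [LinearMap.sum_apply, Pi.single_apply]

end LinForm

lemma homogeneousComponent_mul_of_left {σ R : Type*} [CommRing R] {a : MvPolynomial σ R} {i : ℕ}
    (ha : a.IsHomogeneous i) (j : ℕ) (p : MvPolynomial σ R) :
    homogeneousComponent (i + j) (a * p) = a * homogeneousComponent j p := by
  let _ := MvPolynomial.gradedAlgebra (σ := σ) (R := R)
  have h := DirectSum.coe_decompose_mul_add_of_left_mem (homogeneousSubmodule σ R)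
    (i := i) (j := j) (a := a) (b := p) ((mem_homogeneousSubmodule i a).2 ha)
  erw [decomposition.decompose'_apply, decomposition.decompose'_apply] at h
  exact h

lemma sub_aeval_mem {σ R : Type*} [CommRing R] (I : Ideal (MvPolynomial σ R))
    (g : σ → MvPolynomial σ R) (hg : ∀ i, X i - g i ∈ I) (p : MvPolynomial σ R) :
    p - aeval g p ∈ I := by
  have h : (Ideal.Quotient.mkₐ R I).comp (aeval g) = Ideal.Quotient.mkₐ R I := by
    ext i
    simpa using (Ideal.Quotient.eq.2 (hg i)).symm
  exact Ideal.Quotient.eq.1 (DFunLike.congr_fun h p).symm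

lemma eval_smul_of_isHomogeneous {σ R : Type*} [CommRing R] {Q : MvPolynomial σ R} {n : ℕ}
    (hQ : Q.IsHomogeneous n) (s : R) (x : σ → R) : eval (s • x) Q = s ^ n * eval x Q := by
  rw [eval_eq, eval_eq, Finset.mul_sum]
  refine Finset.sum_congr rfl fun d hd => ?_
  rw [hQ.degree_eq_sum_deg_support hd, ← Finset.prod_pow_eq_pow_sum]
  simp only [Pi.smul_apply, smul_eq_mul, mul_pow, Finset.prod_mul_distrib]
  ring

section Field

variable {k : Type*} [Field k]

/-- A polynomial vanishing where all coordinates in `s` vanish has every monomial divisible by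
some `X i` with `i ∈ s`. -/
lemma exists_ne_zero_of_eval_eq_zero [Infinite k] {σ : Type*} (s : Set σ)
    (g : MvPolynomial σ k) (hg : ∀ y : σ → k, (∀ i ∈ s, y i = 0) → eval y g = 0)
    {m : σ →₀ ℕ} (hm : m ∈ g.support) : ∃ i ∈ s, m i ≠ 0 := by
  classical
  let r : σ → MvPolynomial σ k := fun i => if i ∈ s then 0 else X i
  have hr : aeval r g = 0 := MvPolynomial.funext fun y => by
    rw [map_zero, ← coe_aeval_eq_eval, RingHom.coe_coe, ← AlgHom.comp_apply, comp_aeval]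
    apply hg
    intro i hi
    simp [r, hi]
  have h := sub_aeval_mem (Ideal.span (X '' s)) r (fun i => by
    by_cases hi : i ∈ s
    · simpa [r, hi] using Ideal.subset_span (Set.mem_image_of_mem X hi)
    · simp [r, hi]) g
  rw [hr, sub_zero] at h
  exact mem_ideal_span_X_image.1 h m hm

lemma exists_eq_X_mul_X_mul_add [Infinite k] (g : MvPolynomial (Fin 4) k)
    (h₁ : ∀ y : Fin 4 → k, y 2 = 0 → y 3 = 0 → eval y g = 0)
    (h₂ : ∀ y : Fin 4 → k, y 1 = 0 → y 3 = 0 → eval y g = 0) :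
    ∃ l q, g = X 1 * X 2 * l + X 3 * q := by
  have h : g ∈ Ideal.span ((fun s => monomial s (1 : k)) ''
      {Finsupp.single 1 1 + Finsupp.single 2 1, Finsupp.single 3 1}) := by
    rw [mem_ideal_span_monomial_image]
    intro m hm
    obtain ⟨i, hi, hi'⟩ := exists_ne_zero_of_eval_eq_zero {2, 3} g
      (fun y hy => h₁ y (hy 2 (by simp)) (hy 3 (by simp))) hm
    obtain ⟨j, hj, hj'⟩ := exists_ne_zero_of_eval_eq_zero {1, 3} g
      (fun y hy => h₂ y (hy 1 (by simp)) (hy 3 (by simp))) hm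
    by_cases h3 : m 3 = 0
    · have hi2 : i = 2 := by rcases hi with rfl | rfl <;> simp_all
      have hj1 : j = 1 := by rcases hj with rfl | rfl <;> simp_all
      subst hi2 hj1
      refine ⟨_, Or.inl rfl, fun a => ?_⟩
      fin_cases a <;> simp <;> lia
    · refine ⟨_, Or.inr rfl, fun a => ?_⟩
      fin_cases a <;> (simp; try lia)
  rw [Set.image_pair, Ideal.mem_span_pair] at h
  obtain ⟨l, q, rfl⟩ := h
  refine ⟨l, q, ?_⟩
  have hX : monomial (Finsupp.single 1 1 + Finsupp.single 2 1) (1 : k) =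
      (X 1 * X 2 : MvPolynomial (Fin 4) k) := by simp [X, monomial_mul]
  rw [hX]
  change l * (X 1 * X 2) + q * X 3 = _
  ring

lemma exists_eq_linForm_mul_add [Infinite k] (b : Module.Basis (Fin 4) k (Fin 4 → k))
    {f : MvPolynomial (Fin 4) k} (hf : f.IsHomogeneous 3)
    (h₁ : ∀ x, b.coord 2 x = 0 → b.coord 3 x = 0 → eval x f = 0)
    (h₂ : ∀ x, b.coord 1 x = 0 → b.coord 3 x = 0 → eval x f = 0) :
    ∃ l Q, Q.IsHomogeneous 2 ∧ f = linForm (b.coord 1) * linForm (b.coord 2) * linForm l +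
      linForm (b.coord 3) * Q := by
  let φ : MvPolynomial (Fin 4) k →ₐ[k] MvPolynomial (Fin 4) k :=
    aeval fun i => ∑ j, C (b j i) * X j
  let ψ : MvPolynomial (Fin 4) k →ₐ[k] MvPolynomial (Fin 4) k :=
    aeval fun j => linForm (b.coord j)
  have hφ (y : Fin 4 → k) : eval y (φ f) = eval (∑ j, y j • b j) f := by
    rw [← coe_aeval_eq_eval, RingHom.coe_coe, ← AlgHom.comp_apply, comp_aeval]
    change eval _ f = _
    congr 2
    ext i
    simp [mul_comm]
  have hcoord (y : Fin 4 → k) (i : Fin 4) : b.coord i (∑ j, y j • b j) = y i := by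
    simp [Finsupp.single_apply]
  have hψφ : ψ (φ f) = f := by
    have : ψ.comp φ = AlgHom.id k _ := by
      ext1 i
      refine MvPolynomial.funext fun x => ?_
      have := congrFun (b.sum_repr x) i
      simpa [φ, ψ, eval_linForm, mul_comm] using this
    exact DFunLike.congr_fun this f
  obtain ⟨l, q, hlq⟩ := exists_eq_X_mul_X_mul_add (φ f)
    (fun y hy hy' => by
      rw [hφ]; exact h₁ _ (by rw [hcoord, hy]) (by rw [hcoord, hy']))
    (fun y hy hy' => by
      rw [hφ]; exact h₂ _ (by rw [hcoord, hy]) (by rw [hcoord, hy']))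
  have key : f = linForm (b.coord 1) * linForm (b.coord 2) * ψ l + linForm (b.coord 3) * ψ q := by
    have := congrArg ψ hlq
    rw [hψφ] at this
    simpa [ψ] using this
  obtain ⟨m, hm⟩ := exists_linForm_eq (homogeneousComponent_isHomogeneous 1 (ψ l))
  refine ⟨m, homogeneousComponent 2 (ψ q), homogeneousComponent_isHomogeneous _ _, ?_⟩
  have := congrArg (homogeneousComponent 3) key
  rwa [homogeneousComponent_eq_self hf, map_add,
    homogeneousComponent_mul_of_left (i := 2) (j := 1)
      ((isHomogeneous_linForm _).mul (isHomogeneous_linForm _)),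
    homogeneousComponent_mul_of_left (i := 1) (j := 2) (isHomogeneous_linForm _), ← hm] at this

/-- A form of positive degree has a zero on every line over an algebraically closed field. -/
lemma exists_eval_eq_zero_on_line {K σ : Type*} [Field K] [IsAlgClosed K]
    {Q : MvPolynomial σ K} {n : ℕ} (hn : n ≠ 0) (hQ : Q.IsHomogeneous n) (u v : σ → K) :
    ∃ s t : K, (s ≠ 0 ∨ t ≠ 0) ∧ eval (fun i => s * u i + t * v i) Q = 0 := by
  let p (x y : σ → K) : Polynomial K :=
    aeval (fun i => Polynomial.C (x i) + Polynomial.X * Polynomial.C (y i)) Q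
  have hp (x y : σ → K) (t : K) : (p x y).eval t = eval (fun i => x i + t * y i) Q := by
    rw [← Polynomial.coe_aeval_eq_eval, ← AlgHom.comp_apply, comp_aeval,
      aeval_def, Algebra.algebraMap_self]
    change eval _ Q = _
    congr 2
    ext i
    simpa using mul_comm (y i) t
  by_cases hd : (p u v).degree = 0
  · obtain ⟨c, hc⟩ : ∃ c, p u v = Polynomial.C c :=
      ⟨_, Polynomial.eq_C_of_degree_le_zero hd.le⟩
    have huv (t : K) : eval (fun i => u i + t * v i) Q = c := by
      rw [← hp, hc, Polynomial.eval_C]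
    have hvu : p v u = Polynomial.C c * Polynomial.X ^ n := by
      refine Polynomial.eq_of_infinite_eval_eq _ _
        ((Set.finite_singleton (0 : K)).infinite_compl.mono fun s hs => ?_)
      have hs : s ≠ 0 := hs
      simp only [Set.mem_ofPred_eq, hp]
      have : (fun i => v i + s * u i) = s • fun i => u i + s⁻¹ * v i := by
        ext i
        simp [mul_add, hs, add_comm]
      rw [this, eval_smul_of_isHomogeneous hQ, huv]
      simpa using mul_comm (s ^ n) c
    refine ⟨0, 1, by simp, ?_⟩
    have := hp v u 0
    rw [hvu] at this
    simpa [hn] using this.symm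
  · obtain ⟨t, ht⟩ := IsAlgClosed.exists_root _ hd
    refine ⟨1, t, by simp, ?_⟩
    rw [Polynomial.IsRoot, hp] at ht
    simpa using ht

lemma finrank_le_finrank_inf_ker_add_one (U : Submodule k (Fin 4 → k))
    (m : Module.Dual k (Fin 4 → k)) :
    Module.finrank k U ≤ Module.finrank k ↥(U ⊓ LinearMap.ker m) + 1 := by
  have h₁ := Submodule.finrank_sup_add_finrank_inf_eq U (LinearMap.ker m)
  have h₂ := Submodule.finrank_le (U ⊔ LinearMap.ker m)
  have h₃ := m.finrank_range_add_finrank_ker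
  have h₄ := Submodule.finrank_le (LinearMap.range m)
  simp only [Module.finrank_self] at h₄
  lia

lemma inf_ne_bot_of_finrank {U W H : Submodule k (Fin 4 → k)} (hU : U ≤ H) (hW : W ≤ H)
    (h : Module.finrank k H < Module.finrank k U + Module.finrank k W) : U ⊓ W ≠ ⊥ := by
  intro hbot
  have h₁ := Submodule.finrank_sup_add_finrank_inf_eq U W
  have h₂ := Submodule.finrank_mono (sup_le hU hW)
  rw [hbot, finrank_bot] at h₁
  lia

/-- On a smooth cubic surface, no plane section contains a double line. -/
lemma IsSmoothCubic.finrank_le_one {f : MvPolynomial (Fin 4) k} (hf : IsSmoothCubic k f)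
    {a b m h : Module.Dual k (Fin 4 → k)} {Q : MvPolynomial (Fin 4) k} (hQ : Q.IsHomogeneous 2)
    (hfQ : f = linForm a * linForm b * linForm m + linForm h * Q) :
    Module.finrank k ↥(LinearMap.ker a ⊓ LinearMap.ker m ⊓ LinearMap.ker h) ≤ 1 := by
  set U := LinearMap.ker a ⊓ LinearMap.ker m ⊓ LinearMap.ker h
  by_contra! hU
  obtain ⟨u, huU, hu⟩ := U.exists_mem_ne_zero_of_ne_bot
    (fun h0 => by rw [h0, finrank_bot] at hU; lia)
  obtain ⟨i, hi⟩ := Function.ne_iff.1 hu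
  have hle := finrank_le_finrank_inf_ker_add_one U (LinearMap.proj i)
  obtain ⟨v, ⟨hvU, hvi⟩, hv⟩ := (U ⊓ LinearMap.ker (LinearMap.proj i)).exists_mem_ne_zero_of_ne_bot
    (fun h0 => by rw [h0, finrank_bot] at hle; lia)
  obtain ⟨j, hj⟩ := Function.ne_iff.1 hv
  let K := AlgebraicClosure k
  obtain ⟨s, t, hst, h0⟩ := exists_eval_eq_zero_on_line (K := K) two_ne_zero
    (hQ.map (algebraMap k K))
    (fun i => algebraMap k K (u i)) (fun i => algebraMap k K (v i))
  have ha := eval_map_linForm (K := K) a huU.1.1 hvU.1.1 s t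
  have hm := eval_map_linForm (K := K) m huU.1.2 hvU.1.2 s t
  have hh := eval_map_linForm (K := K) h huU.2 hvU.2 s t
  have hx := hf.2.2 (fun i => s * algebraMap k K (u i) + t * algebraMap k K (v i)) ⟨by
      simp only [hfQ, map_add, map_mul]
      rw [ha, hh]; ring, fun i => by
      simp only [hfQ, map_add, map_mul, Derivation.leibniz, smul_eq_mul]
      rw [ha, hh, hm, h0]; ring⟩
  replace hi : u i ≠ 0 := hi
  replace hj : v j ≠ 0 := hj
  have hs : s = 0 := by
    have := congrFun hx i
    have hvi : v i = 0 := hvi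
    simpa [hvi, hi] using this
  have ht : t = 0 := by
    have := congrFun hx j
    simpa [hs, hj] using this
  simp [hs, ht] at hst

lemma derivative_aeval {σ : Type*} [Fintype σ] (g : σ → Polynomial k) (p : MvPolynomial σ k) :
    Polynomial.derivative (aeval g p) =
      ∑ i, aeval g (pderiv i p) * Polynomial.derivative (g i) := by
  classical
  induction p using MvPolynomial.induction_on with
  | C a => simp [Polynomial.algebraMap_eq]
  | add p q hp hq => simp [hp, hq, add_mul, Finset.sum_add_distrib]
  | mul_X p j hp =>
    simp only [map_mul, aeval_X, Polynomial.derivative_mul, hp, Derivation.leibniz, pderiv_X,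
      smul_eq_mul, map_add, add_mul, Finset.sum_add_distrib, Finset.sum_mul]
    rw [add_comm]
    refine congrArg₂ (· + ·) ?_ ?_
    · simp [Pi.single_apply, apply_ite]
    · exact Finset.sum_congr rfl fun i _ => by ring

lemma sum_eval_pderiv_mul_eq_zero [Infinite k] {f : MvPolynomial (Fin 4) k} {v w : Fin 4 → k}
    (h : ∀ t : k, eval (v + t • w) f = 0) : ∑ i, eval v (pderiv i f) * w i = 0 := by
  let g : Fin 4 → Polynomial k := fun i => Polynomial.C (v i) + Polynomial.C (w i) * Polynomial.X
  have hg (t : k) (p : MvPolynomial (Fin 4) k) : (aeval g p).eval t = eval (v + t • w) p := by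
    rw [← Polynomial.coe_aeval_eq_eval, ← AlgHom.comp_apply, comp_aeval]
    change eval _ p = _
    congr 2
    ext i
    simpa [g] using mul_comm (w i) t
  have h0 : aeval g f = 0 := Polynomial.funext fun t => by rw [hg, h, Polynomial.eval_zero]
  have := congrArg (Polynomial.eval 0) (derivative_aeval g f)
  rw [h0, Polynomial.eval_finsetSum] at this
  simpa [hg, g] using this.symm

lemma eval_lineRestrict (f : MvPolynomial (Fin 4) k) (v w : Fin 4 → k) (y : Fin 2 → k) :
    eval y (lineRestrict f v w) = eval (y 0 • v + y 1 • w) f := by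
  rw [lineRestrict, ← coe_aeval_eq_eval, RingHom.coe_coe, ← AlgHom.comp_apply, comp_aeval]
  change eval _ f = _
  congr 2
  ext i
  simp [mul_comm]

lemma isLineOn_iff [Infinite k] {f : MvPolynomial (Fin 4) k} {W : Submodule k (Fin 4 → k)} :
    IsLineOn f W ↔ Module.finrank k W = 2 ∧ ∀ x ∈ W, eval x f = 0 := by
  refine and_congr_right fun hW => ⟨?_, fun h => ?_⟩
  · rintro ⟨v, w, rfl, h⟩ x hx
    obtain ⟨s, t, rfl⟩ := Submodule.mem_span_pair.1 hx
    simpa [h] using (eval_lineRestrict f v w ![s, t]).symm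
  · let b := Module.finBasisOfFinrankEq k W hW
    refine ⟨b 0, b 1, ?_, ?_⟩
    · have := congrArg (Submodule.map W.subtype) b.span_eq
      rw [Submodule.map_span, ← Set.range_comp, Submodule.map_top, Submodule.range_subtype] at this
      refine Eq.trans (congrArg _ ?_) this
      ext x
      simp [Fin.exists_fin_two, eq_comm]
    · refine MvPolynomial.funext fun y => ?_
      rw [eval_lineRestrict]
      exact (h _ (W.add_mem (W.smul_mem (y 0) (b 0).2) (W.smul_mem (y 1) (b 1).2))).trans
        (map_zero _).symm

lemma IsLineOn.eq_of_le {f : MvPolynomial (Fin 4) k} {U W : Submodule k (Fin 4 → k)}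
    (hU : IsLineOn f U) (hW : IsLineOn f W) (h : U ≤ W) : U = W :=
  Submodule.eq_of_le_of_finrank_eq h (hU.1.trans hW.1.symm)

/-- Concurrent lines on a smooth cubic surface lie in the tangent plane. -/
lemma IsSmoothCubic.iSup_ne_top_of_mem [Infinite k] {f : MvPolynomial (Fin 4) k}
    (hf : IsSmoothCubic k f) {v : Fin 4 → k} (hv : v ≠ 0) {ι : Type*} [Nonempty ι]
    {W : ι → Submodule k (Fin 4 → k)}
    (hW : ∀ i, IsLineOn f (W i)) (hvW : ∀ i, v ∈ W i) : ⨆ i, W i ≠ ⊤ := by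
  intro htop
  let D : Module.Dual k (Fin 4 → k) := ∑ i, eval v (pderiv i f) • LinearMap.proj i
  have hD : LinearMap.ker D = ⊤ := by
    rw [eq_top_iff, ← htop, iSup_le_iff]
    intro i w hw
    simpa [D] using sum_eval_pderiv_mul_eq_zero fun t =>
      (isLineOn_iff.1 (hW i)).2 _ ((W i).add_mem (hvW i) ((W i).smul_mem t hw))
  let K := AlgebraicClosure k
  have heval (p : MvPolynomial (Fin 4) k) :
      eval (fun i => algebraMap k K (v i)) (map (algebraMap k K) p) = algebraMap k K (eval v p) := by
    rw [eval_map, eval₂_comp]; rfl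
  have h0 := hf.2.2 (fun i => algebraMap k K (v i)) ⟨by
    rw [heval, (isLineOn_iff.1 (hW (Classical.arbitrary ι))).2 v (hvW _), map_zero], fun i => by
    have : D (Pi.single i 1) = 0 := LinearMap.mem_ker.1 (hD ▸ Submodule.mem_top)
    rw [heval, show eval v (pderiv i f) = 0 by simpa [D, Pi.single_apply] using this, map_zero]⟩
  exact hv (funext fun i => by simpa using congrFun h0 i)

/-- A basis adapted to two distinct intersecting planes in `k⁴`. -/
lemma exists_basis_of_inf_ne_bot {W₁ W₂ : Submodule k (Fin 4 → k)}
    (h₁ : Module.finrank k W₁ = 2) (h₂ : Module.finrank k W₂ = 2) (hne : W₁ ≠ W₂)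
    (hmeet : W₁ ⊓ W₂ ≠ ⊥) : ∃ b : Module.Basis (Fin 4) k (Fin 4 → k),
      W₁ = LinearMap.ker (b.coord 2) ⊓ LinearMap.ker (b.coord 3) ∧
      W₂ = LinearMap.ker (b.coord 1) ⊓ LinearMap.ker (b.coord 3) := by
  obtain ⟨e₀, ⟨h01, h02⟩, h0⟩ := (W₁ ⊓ W₂).exists_mem_ne_zero_of_ne_bot hmeet
  obtain ⟨e₁, h11, h12⟩ := SetLike.not_le_iff_exists.1
    fun h => hne (Submodule.eq_of_le_of_finrank_eq h (h₁.trans h₂.symm))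
  obtain ⟨e₂, h22, h21⟩ := SetLike.not_le_iff_exists.1
    fun h => hne (Submodule.eq_of_le_of_finrank_eq h (h₂.trans h₁.symm)).symm
  have hsup : W₁ ⊔ W₂ ≠ ⊤ := fun h => by
    have := Submodule.finrank_sup_add_finrank_inf_eq W₁ W₂
    rw [h, finrank_top, Module.finrank_fin_fun, h₁, h₂] at this
    exact hmeet (Submodule.finrank_eq_zero.1 (by lia))
  obtain ⟨e₃, -, h3⟩ := SetLike.exists_of_lt hsup.lt_top
  have aux {W : Submodule k (Fin 4 → k)} {x : Fin 4 → k} (hx : x ∉ W) {c : k} (h : c • x ∈ W) :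
      c = 0 := by
    by_contra hc
    exact hx ((W.smul_mem_iff hc).1 h)
  have aux₃ {c : Fin 4 → k} (h : c 0 • e₀ + c 1 • e₁ + c 2 • e₂ + c 3 • e₃ ∈ W₁ ⊔ W₂) :
      c 3 = 0 := by
    refine aux h3 (((W₁ ⊔ W₂).add_mem_iff_right ?_).1 h)
    have h₁ := le_sup_left (a := W₁) (b := W₂)
    have h₂ := le_sup_right (a := W₁) (b := W₂)
    exact add_mem (add_mem (Submodule.smul_mem _ _ (h₁ h01)) (Submodule.smul_mem _ _ (h₁ h11)))
      (Submodule.smul_mem _ _ (h₂ h22))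
  have aux₁ {c : Fin 4 → k} (h : c 0 • e₀ + c 1 • e₁ + c 2 • e₂ + c 3 • e₃ ∈ W₁) :
      c 2 = 0 ∧ c 3 = 0 := by
    have hc := aux₃ ((le_sup_left : W₁ ≤ W₁ ⊔ W₂) h)
    rw [hc, zero_smul, add_zero, W₁.add_mem_iff_right
      (add_mem (W₁.smul_mem _ h01) (W₁.smul_mem _ h11))] at h
    exact ⟨aux h21 h, hc⟩
  have aux₂ {c : Fin 4 → k} (h : c 0 • e₀ + c 1 • e₁ + c 2 • e₂ + c 3 • e₃ ∈ W₂) :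
      c 1 = 0 ∧ c 3 = 0 := by
    have hc := aux₃ ((le_sup_right : W₂ ≤ W₁ ⊔ W₂) h)
    rw [hc, zero_smul, add_zero, W₂.add_mem_iff_left (W₂.smul_mem _ h22),
      W₂.add_mem_iff_right (W₂.smul_mem _ h02)] at h
    exact ⟨aux h12 h, hc⟩
  have hli : LinearIndependent k ![e₀, e₁, e₂, e₃] := by
    rw [Fintype.linearIndependent_iff]
    intro c hc
    simp only [Fin.sum_univ_four] at hc
    change c 0 • e₀ + c 1 • e₁ + c 2 • e₂ + c 3 • e₃ = 0 at hc
    have h₁ := aux₁ (c := c) (hc ▸ W₁.zero_mem)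
    have h₂ := aux₂ (c := c) (hc ▸ W₂.zero_mem)
    have h₀ : c 0 = 0 := by simpa [h₁, h₂, h0] using hc
    intro i
    fin_cases i
    exacts [h₀, h₂.1, h₁.1, h₁.2]
  let b := basisOfLinearIndependentOfCardEqFinrank hli (by simp)
  have hb (x : Fin 4 → k) :
      b.coord 0 x • e₀ + b.coord 1 x • e₁ + b.coord 2 x • e₂ + b.coord 3 x • e₃ = x := by
    have := b.sum_repr x
    rw [Fin.sum_univ_four] at this
    simpa [b] using this
  refine ⟨b, ?_, ?_⟩
  · ext x
    constructor
    · intro hx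
      exact aux₁ (c := fun i => b.coord i x) ((hb x).symm ▸ hx)
    · rintro ⟨hx, hx'⟩
      rw [SetLike.mem_coe, LinearMap.mem_ker] at hx hx'
      rw [← hb x, hx, hx', zero_smul, zero_smul, add_zero, add_zero]
      exact add_mem (W₁.smul_mem _ h01) (W₁.smul_mem _ h11)
  · ext x
    constructor
    · intro hx
      exact aux₂ (c := fun i => b.coord i x) ((hb x).symm ▸ hx)
    · rintro ⟨hx, hx'⟩
      rw [SetLike.mem_coe, LinearMap.mem_ker] at hx hx'
      rw [← hb x, hx, hx', zero_smul, zero_smul, add_zero, add_zero]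
      exact add_mem (W₂.smul_mem _ h02) (W₂.smul_mem _ h22)

lemma IsSmoothCubic.inf_eq_bot_or_inf_eq_bot [Infinite k] {f : MvPolynomial (Fin 4) k}
    (hf : IsSmoothCubic k f) {H U W d : Submodule k (Fin 4 → k)} (hU : IsLineOn f U)
    (hW : IsLineOn f W) (hd : IsLineOn f d) (hUH : U ≤ H) (hWH : W ≤ H) (hUW : U ≠ W)
    (hdH : ¬ d ≤ H) : d ⊓ U = ⊥ ∨ d ⊓ W = ⊥ := by
  by_contra! h
  obtain ⟨v, ⟨hvd, hvU⟩, hv⟩ := (d ⊓ U).exists_mem_ne_zero_of_ne_bot h.1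
  have hlt : Module.finrank k ↥(d ⊓ H) < 2 :=
    hd.1 ▸ Submodule.finrank_lt_finrank_of_lt (inf_lt_left.2 hdH)
  have hpos : Module.finrank k ↥(d ⊓ W) ≠ 0 := fun h0 => h.2 (Submodule.finrank_eq_zero.1 h0)
  have heq : d ⊓ W = d ⊓ H :=
    Submodule.eq_of_le_of_finrank_le (inf_le_inf_left d hWH) (by lia)
  have hvW : v ∈ W := (heq.ge ⟨hvd, hUH hvU⟩).2
  refine hf.iSup_ne_top_of_mem hv (W := ![d, U, W]) ?_ ?_ ?_
  · intro i; fin_cases i <;> assumption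
  · intro i; fin_cases i <;> assumption
  · have h₁ : U < U ⊔ W := left_lt_sup.2 fun hle => hUW (hW.eq_of_le hU hle).symm
    have h₂ : U ⊔ W < d ⊔ (U ⊔ W) :=
      right_lt_sup.2 fun hle => hdH (hle.trans (sup_le hUH hWH))
    have hlt₁ := Submodule.finrank_lt_finrank_of_lt h₁
    have hlt₂ := Submodule.finrank_lt_finrank_of_lt h₂
    have h2 := hU.1
    have htop : d ⊔ (U ⊔ W) = ⊤ :=
      Submodule.eq_top_of_finrank_eq (le_antisymm (Submodule.finrank_le _) (by
        rw [Module.finrank_fin_fun]; lia))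
    rw [eq_top_iff, ← htop]
    exact sup_le (le_iSup ![d, U, W] 0) (sup_le (le_iSup ![d, U, W] 1) (le_iSup ![d, U, W] 2))

/-- A subspace covered by three subspaces over an infinite field lies in one of them. -/
lemma le_or_le_or_le_of_subset_union [Infinite k] {V : Type*} [AddCommGroup V] [Module k V]
    {d U₁ U₂ U₃ : Submodule k V} (h : ∀ x ∈ d, x ∈ U₁ ∨ x ∈ U₂ ∨ x ∈ U₃) :
    d ≤ U₁ ∨ d ≤ U₂ ∨ d ≤ U₃ := by
  obtain ⟨i, hi⟩ := Subspace.exists_eq_top_of_iUnion_eq_univ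
    (p := fun i : Fin 3 => (![U₁, U₂, U₃] i).comap d.subtype) (by
      rw [Set.eq_univ_iff_forall]
      rintro ⟨x, hx⟩
      rw [Set.mem_iUnion, Fin.exists_fin_succ, Fin.exists_fin_two]
      exact h x hx)
  rw [Submodule.comap_subtype_eq_top] at hi
  fin_cases i
  exacts [Or.inl hi, Or.inr (Or.inl hi), Or.inr (Or.inr hi)]

/-- Two distinct intersecting lines on a smooth cubic surface are part of a tritangent
triangle, and any further line meets exactly one side of this triangle. -/
lemma IsSmoothCubic.exists_tritangent [Infinite k] {f : MvPolynomial (Fin 4) k}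
    (hf : IsSmoothCubic k f) {W₁ W₂ : Submodule k (Fin 4 → k)} (h₁ : IsLineOn f W₁)
    (h₂ : IsLineOn f W₂) (hne : W₁ ≠ W₂) (hmeet : W₁ ⊓ W₂ ≠ ⊥) :
    ∃ W₃, IsLineOn f W₃ ∧ W₁ ≠ W₃ ∧ W₂ ≠ W₃ ∧ W₁ ⊓ W₃ ≠ ⊥ ∧ W₂ ⊓ W₃ ≠ ⊥ ∧
      ∀ d, IsLineOn f d → d ≠ W₁ → d ≠ W₂ → d ≠ W₃ →
        (d ⊓ W₁ ≠ ⊥ ∨ d ⊓ W₂ ≠ ⊥ ∨ d ⊓ W₃ ≠ ⊥) ∧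
        (d ⊓ W₁ = ⊥ ∨ d ⊓ W₂ = ⊥) ∧ (d ⊓ W₁ = ⊥ ∨ d ⊓ W₃ = ⊥) ∧
        (d ⊓ W₂ = ⊥ ∨ d ⊓ W₃ = ⊥) := by
  obtain ⟨b, hb₁, hb₂⟩ := exists_basis_of_inf_ne_bot h₁.1 h₂.1 hne hmeet
  obtain ⟨l, Q, hQ, hfQ⟩ := exists_eq_linForm_mul_add b hf.2.1
    (fun x hx hx' => (isLineOn_iff.1 h₁).2 x (hb₁ ▸ ⟨hx, hx'⟩))
    (fun x hx hx' => (isLineOn_iff.1 h₂).2 x (hb₂ ▸ ⟨hx, hx'⟩))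
  set H := LinearMap.ker (b.coord 3)
  have hH : Module.finrank k H = 3 := by
    have := Module.Dual.finrank_ker_add_one_of_ne_zero (f := b.coord 3)
      (fun h0 => by simpa using DFunLike.congr_fun h0 (b 3))
    rw [Module.finrank_fin_fun] at this
    exact Nat.succ_injective this
  have hzero (x : Fin 4 → k) (hx : x ∈ H) :
      eval x f = b.coord 1 x * b.coord 2 x * l x := by
    rw [hfQ]
    simp only [map_add, map_mul, eval_linForm]
    rw [LinearMap.mem_ker.1 hx]
    ring
  let W₃ := LinearMap.ker l ⊓ H
  have hl₁ : Module.finrank k ↥(LinearMap.ker (b.coord 1) ⊓ LinearMap.ker l ⊓ H) ≤ 1 :=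
    hf.finrank_le_one hQ hfQ
  have hl₂ : Module.finrank k ↥(LinearMap.ker (b.coord 2) ⊓ LinearMap.ker l ⊓ H) ≤ 1 :=
    hf.finrank_le_one hQ (b := b.coord 1) (hfQ.trans (by rw [mul_comm (linForm (b.coord 1))]))
  have h₃ : IsLineOn f W₃ := by
    refine isLineOn_iff.2 ⟨le_antisymm ?_ ?_, fun x hx => ?_⟩
    · have := finrank_le_finrank_inf_ker_add_one W₃ (b.coord 1)
      rw [inf_comm, ← inf_assoc] at this
      exact this.trans (Nat.succ_le_succ hl₁)
    · have := finrank_le_finrank_inf_ker_add_one H l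
      rw [inf_comm, hH] at this
      exact Nat.le_of_succ_le_succ this
    · rw [hzero x hx.2, LinearMap.mem_ker.1 hx.1, mul_zero]
  have ne_of {m : Module.Dual k (Fin 4 → k)} {W : Submodule k (Fin 4 → k)} (hW : IsLineOn f W)
      (hm : Module.finrank k ↥(LinearMap.ker m ⊓ LinearMap.ker l ⊓ H) ≤ 1)
      (hWm : W = LinearMap.ker m ⊓ H) : W ≠ W₃ := fun heq => by
    have hle : W ≤ LinearMap.ker m ⊓ LinearMap.ker l ⊓ H :=
      le_inf (le_inf (hWm.le.trans inf_le_left) (heq.le.trans inf_le_left))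
        (hWm.le.trans inf_le_right)
    have := Submodule.finrank_mono hle
    rw [hW.1] at this
    lia
  have h₁₃ := ne_of h₁ hl₂ hb₁
  have h₂₃ := ne_of h₂ hl₁ hb₂
  have hH₁ : W₁ ≤ H := hb₁.le.trans inf_le_right
  have hH₂ : W₂ ≤ H := hb₂.le.trans inf_le_right
  have hH₃ : W₃ ≤ H := inf_le_right
  have hmem (x : Fin 4 → k) (hx : x ∈ H) (h0 : eval x f = 0) : x ∈ W₁ ∨ x ∈ W₂ ∨ x ∈ W₃ := by
    rw [hzero x hx, mul_eq_zero, mul_eq_zero] at h0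
    rcases h0 with (h0 | h0) | h0
    · exact Or.inr (Or.inl (hb₂ ▸ ⟨h0, hx⟩))
    · exact Or.inl (hb₁ ▸ ⟨h0, hx⟩)
    · exact Or.inr (Or.inr ⟨h0, hx⟩)
  refine ⟨W₃, h₃, h₁₃, h₂₃, inf_ne_bot_of_finrank hH₁ hH₃ (by rw [hH, h₁.1, h₃.1]; simp),
    inf_ne_bot_of_finrank hH₂ hH₃ (by rw [hH, h₂.1, h₃.1]; simp),
    fun d hd hd₁ hd₂ hd₃ => ⟨?_, ?_⟩⟩
  · have hdH : d ⊓ H ≠ ⊥ := inf_ne_bot_of_finrank le_top le_top (by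
      rw [hH, hd.1, finrank_top, Module.finrank_fin_fun]; simp)
    obtain ⟨v, ⟨hvd, hvH⟩, hv⟩ := (d ⊓ H).exists_mem_ne_zero_of_ne_bot hdH
    have meet {W : Submodule k (Fin 4 → k)} (hvW : v ∈ W) : d ⊓ W ≠ ⊥ :=
      (Submodule.ne_bot_iff _).2 ⟨v, ⟨hvd, hvW⟩, hv⟩
    exact (hmem v hvH ((isLineOn_iff.1 hd).2 v hvd)).imp meet (Or.imp meet meet)
  · have hdH : ¬ d ≤ H := fun hle => by
      rcases le_or_le_or_le_of_subset_union
        (fun x hx => hmem x (hle hx) ((isLineOn_iff.1 hd).2 x hx)) with h | h | h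
      exacts [hd₁ (hd.eq_of_le h₁ h), hd₂ (hd.eq_of_le h₂ h), hd₃ (hd.eq_of_le h₃ h)]
    exact ⟨hf.inf_eq_bot_or_inf_eq_bot h₁ h₂ hd hH₁ hH₂ hne hdH,
      hf.inf_eq_bot_or_inf_eq_bot h₁ h₃ hd hH₁ hH₃ h₁₃ hdH,
      hf.inf_eq_bot_or_inf_eq_bot h₂ h₃ hd hH₂ hH₃ h₂₃ hdH⟩

end Field

/-- Three elements of `L`, pairwise related by `M`, such that every other element of `L` is
related to exactly one of them. -/
structure IsTritangent {α : Type*} (L : Set α) (M : α → α → Prop) (a b c : α) : Prop where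
  mem₁ : a ∈ L
  mem₂ : b ∈ L
  mem₃ : c ∈ L
  ne₁₂ : a ≠ b
  ne₁₃ : a ≠ c
  ne₂₃ : b ≠ c
  rel₁₂ : M a b
  rel₁₃ : M a c
  rel₂₃ : M b c
  exists_rel : ∀ d ∈ L, d ≠ a → d ≠ b → d ≠ c → M d a ∨ M d b ∨ M d c
  unique : ∀ d ∈ L, d ≠ a → d ≠ b → d ≠ c →
    (¬ M d a ∨ ¬ M d b) ∧ (¬ M d a ∨ ¬ M d c) ∧ (¬ M d b ∨ ¬ M d c)

section Incidence

variable {α : Type*} {L : Set α} {M : α → α → Prop} {a b c d : α}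

lemma IsTritangent.rotate (hM : ∀ x y, M x y → M y x) (h : IsTritangent L M a b c) :
    IsTritangent L M b c a where
  mem₁ := h.mem₂
  mem₂ := h.mem₃
  mem₃ := h.mem₁
  ne₁₂ := h.ne₂₃
  ne₁₃ := h.ne₁₂.symm
  ne₂₃ := h.ne₁₃.symm
  rel₁₂ := h.rel₂₃
  rel₁₃ := hM _ _ h.rel₁₂
  rel₂₃ := hM _ _ h.rel₁₃
  exists_rel d hd hb hc ha := by have := h.exists_rel d hd ha hb hc; tauto
  unique d hd hb hc ha := by have := h.unique d hd ha hb hc; tauto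

lemma IsTritangent.ncard_eq_five (hM : ∀ x y, M x y → M y x)
    (hskew : ∀ a ∈ L, ∀ b ∈ L, ∀ c ∈ L, a ≠ b → a ≠ c → b ≠ c → M a b ∨ M a c ∨ M b c)
    (htri : ∀ a ∈ L, ∀ b ∈ L, a ≠ b → M a b → ∃ c, IsTritangent L M a b c)
    (h : IsTritangent L M a b c) (hd : d ∈ L) (hda : d ≠ a) (hdb : d ≠ b) (hdc : d ≠ c)
    (hMd : M d a) : L.Finite ∧ L.ncard = 5 := by
  classical
  obtain ⟨e, h'⟩ := htri a h.mem₁ d hd hda.symm (hM _ _ hMd)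
  have ha := h.mem₁
  have hb := h.mem₂
  have hc := h.mem₃
  have he := h'.mem₃
  have hab := h.ne₁₂
  have hac := h.ne₁₃
  have hbc := h.ne₂₃
  have hea := h'.ne₁₃.symm
  have hed := h'.ne₂₃.symm
  have hMe := hM _ _ h'.rel₁₃
  have ud := h.unique d hd hda hdb hdc
  have heb : e ≠ b := fun heq => by
    have := h'.rel₂₃; rw [heq] at this; tauto
  have hec : e ≠ c := fun heq => by
    have := h'.rel₂₃; rw [heq] at this; tauto
  have ue := h.unique e he hea heb hec
  have hL : L = ({a, b, c, d, e} : Finset α) := by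
    ext x
    simp only [Finset.coe_insert, Finset.coe_singleton, Set.mem_insert_iff,
      Set.mem_singleton_iff]
    refine ⟨fun hx => ?_, by rintro (rfl | rfl | rfl | rfl | rfl) <;> assumption⟩
    by_contra! hne
    obtain ⟨hxa, hxb, hxc, hxd, hxe⟩ := hne
    have ex := h.exists_rel x hx hxa hxb hxc
    have ux := h.unique x hx hxa hxb hxc
    have ex' := h'.exists_rel x hx hxa hxd hxe
    have ux' := h'.unique x hx hxa hxd hxe
    have sbd := hskew x hx b hb d hd hxb hxd hdb.symm
    have sbe := hskew x hx b hb e he hxb hxe heb.symm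
    have scd := hskew x hx c hc d hd hxc hxd hdc.symm
    have sce := hskew x hx c hc e he hxc hxe hec.symm
    have mbd := hM b d
    have mbe := hM b e
    have mcd := hM c d
    have mce := hM c e
    grind
  refine ⟨hL ▸ Finset.finite_toSet _, ?_⟩
  rw [hL, Set.ncard_coe_finset]
  have := hda.symm
  have := hdb.symm
  have := hdc.symm
  have := hea.symm
  have := heb.symm
  have := hec.symm
  have := hed.symm
  simp [*]

lemma ncard_mem_of_tritangent (hM : ∀ x y, M x y → M y x)
    (hskew : ∀ a ∈ L, ∀ b ∈ L, ∀ c ∈ L, a ≠ b → a ≠ c → b ≠ c → M a b ∨ M a c ∨ M b c)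
    (htri : ∀ a ∈ L, ∀ b ∈ L, a ≠ b → M a b → ∃ c, IsTritangent L M a b c) :
    L.Finite ∧ L.ncard ∈ ({0, 1, 2, 3, 5} : Set ℕ) := by
  classical
  by_cases hmeet : ∃ a ∈ L, ∃ b ∈ L, a ≠ b ∧ M a b
  · obtain ⟨a, ha, b, hb, hab, hMab⟩ := hmeet
    obtain ⟨c, h⟩ := htri a ha b hb hab hMab
    by_cases hL : L ⊆ ({a, b, c} : Finset α)
    · have hL' : L = ({a, b, c} : Finset α) := by
        refine hL.antisymm fun x hx => ?_
        simp only [Finset.coe_insert, Finset.coe_singleton, Set.mem_insert_iff,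
          Set.mem_singleton_iff] at hx
        rcases hx with rfl | rfl | rfl
        exacts [ha, hb, h.mem₃]
      refine ⟨hL' ▸ Finset.finite_toSet _, ?_⟩
      rw [hL', Set.ncard_coe_finset, Finset.card_eq_three.2 ⟨a, b, c, hab, h.ne₁₃, h.ne₂₃, rfl⟩]
      simp
    · obtain ⟨d, hd, hd'⟩ := Set.not_subset.1 hL
      simp only [Finset.coe_insert, Finset.coe_singleton, Set.mem_insert_iff,
        Set.mem_singleton_iff, not_or] at hd'
      obtain ⟨hda, hdb, hdc⟩ := hd'
      suffices L.Finite ∧ L.ncard = 5 from ⟨this.1, by simp [this.2]⟩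
      rcases h.exists_rel d hd hda hdb hdc with hMd | hMd | hMd
      · exact h.ncard_eq_five hM hskew htri hd hda hdb hdc hMd
      · exact (h.rotate hM).ncard_eq_five hM hskew htri hd hdb hdc hda hMd
      · exact ((h.rotate hM).rotate hM).ncard_eq_five hM hskew htri hd hdc hda hdb hMd
  · push Not at hmeet
    have hle : L.encard ≤ 2 := by
      by_contra! hlt
      obtain ⟨t, htL, ht⟩ := Set.exists_subset_encard_eq (Order.add_one_le_of_lt hlt)
      obtain ⟨a, b, c, hab, hac, hbc, rfl⟩ := Set.encard_eq_three.1 (ht.trans two_add_one_eq_three)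
      have ha : a ∈ L := htL (by simp)
      have hb : b ∈ L := htL (by simp)
      have hc : c ∈ L := htL (by simp)
      rcases hskew a ha b hb c hc hab hac hbc with h | h | h
      exacts [hmeet a ha b hb hab h, hmeet a ha c hc hac h, hmeet b hb c hc hbc h]
    have hfin : L.Finite := Set.finite_of_encard_le_coe hle
    refine ⟨hfin, ?_⟩
    rw [← hfin.cast_ncard_eq] at hle
    have hle : L.ncard ≤ 2 := by exact_mod_cast hle
    interval_cases L.ncard <;> simp

end Incidence

/-- a smooth cubic surface over ℚ with no skew triple of ℚ-lines has
0, 1, 2, 3, or 5 rational lines. -/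
theorem line_count_no_skew_triple_rat (f : MvPolynomial (Fin 4) ℚ)
    (hf : IsSmoothCubic ℚ f)
    (hskew : ∀ W₁ W₂ W₃ : Submodule ℚ (Fin 4 → ℚ),
      IsLineOn f W₁ → IsLineOn f W₂ → IsLineOn f W₃ →
      W₁ ≠ W₂ → W₁ ≠ W₃ → W₂ ≠ W₃ →
      W₁ ⊓ W₂ ≠ ⊥ ∨ W₁ ⊓ W₃ ≠ ⊥ ∨ W₂ ⊓ W₃ ≠ ⊥) :
    {W : Submodule ℚ (Fin 4 → ℚ) | IsLineOn f W}.Finite ∧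
      {W : Submodule ℚ (Fin 4 → ℚ) | IsLineOn f W}.ncard ∈
        ({0, 1, 2, 3, 5} : Set ℕ) := by
  refine ncard_mem_of_tritangent (M := fun U W => U ⊓ W ≠ ⊥)
    (fun U W h => by rwa [inf_comm])
    (fun a ha b hb c hc => hskew a b c ha hb hc) fun a ha b hb hab hmeet => ?_
  obtain ⟨c, hc, hac, hbc, hMac, hMbc, h⟩ := hf.exists_tritangent ha hb hab hmeet
  exact ⟨c, ha, hb, hc, hab, hac, hbc, hmeet, hMac, hMbc,
    fun d hd hda hdb hdc => (h d hd hda hdb hdc).1,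
    fun d hd hda hdb hdc => by simpa only [not_not] using (h d hd hda hdb hdc).2⟩
end

section
/- Let k be a field and let f be a nonzero homogeneous polynomial of degree 3 in four variables over k defining a smooth cubic surface V(f). If no three lines on V(f) defined over k form a skew triple (among any three distinct k-lines, at least two intersect), then V(f) contains at most six lines defined over k. -/
open MvPolynomial

/-- Three pairwise related points such that every other point is related to exactly one of
them. -/
structure IsTriad {L : Type*} (M : L → L → Prop) (a b c : L) : Prop where
  ne₁₂ : a ≠ b
  ne₁₃ : a ≠ c
  ne₂₃ : b ≠ c
  rel₁₂ : M a b
  rel₁₃ : M a c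
  rel₂₃ : M b c
  exactly_one : ∀ d, d ≠ a → d ≠ b → d ≠ c →
    (M d a ∧ ¬ M d b ∧ ¬ M d c) ∨ (¬ M d a ∧ M d b ∧ ¬ M d c) ∨ (¬ M d a ∧ ¬ M d b ∧ M d c)

theorem IsTriad.swap {L : Type*} {M : L → L → Prop} (hM : ∀ a b, M a b → M b a) {a b c : L}
    (h : IsTriad M a b c) : IsTriad M a c b :=
  ⟨h.ne₁₃, h.ne₁₂, h.ne₂₃.symm, h.rel₁₃, h.rel₁₂, hM _ _ h.rel₂₃, fun d h₁ h₂ h₃ => by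
    have := h.exactly_one d h₁ h₃ h₂; tauto⟩

theorem seven_points_false {L : Type*} {M : L → L → Prop} (hM : ∀ a b, M a b → M b a)
    (htri : ∀ a b, a ≠ b → M a b → ∃ c, IsTriad M a b c)
    {a b c d e x y : L} (habc : IsTriad M a b c) (hade : IsTriad M a d e) (hxyb : IsTriad M x y b)
    (hd : d ≠ b ∧ d ≠ c) (he : e ≠ b ∧ e ≠ c)
    (hx : ¬ M a x) (hy : ¬ M a y)
    (hall : ∀ g, g = a ∨ g = b ∨ g = c ∨ g = d ∨ g = e ∨ g = x ∨ g = y) : False := by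
  -- the case where `x` meets `d`; the other case follows by exchanging `d` and `e`
  have key : ∀ d e, IsTriad M a d e → d ≠ b → d ≠ c →
      (∀ g, g = a ∨ g = b ∨ g = c ∨ g = d ∨ g = e ∨ g = x ∨ g = y) → ¬ M x d := by
    intro d e hade hdb hdc hall hxd
    have hxd' : x ≠ d := fun h => hx (h ▸ hade.rel₁₂)
    obtain ⟨g, hg⟩ := htri x d hxd' hxd
    have hxa : x ≠ a := fun h => hy (h ▸ hxyb.rel₁₂)
    have hxb : x ≠ b := hxyb.ne₁₃
    have hxc : x ≠ c := fun h => hx (h ▸ habc.rel₁₃)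
    have hxe : x ≠ e := fun h => hx (h ▸ hade.rel₁₃)
    have h₁ := habc.exactly_one x hxa hxb hxc
    have h₂ := hade.exactly_one x hxa hxd' hxe
    have h₃ := habc.exactly_one d hade.ne₁₂.symm hdb hdc
    have hda := hM _ _ hade.rel₁₂
    have hdy : d ≠ y := fun h => hy (h ▸ hade.rel₁₂)
    have h₄ := hxyb.exactly_one d hxd'.symm hdy hdb
    have h₅ := hM _ _ hxd
    have h₆ := hg.rel₁₃
    have h₇ := hg.rel₂₃
    have h₈ := hg.ne₁₃
    have h₉ := hg.ne₂₃
    have h₁₀ := hxyb.rel₁₃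
    have h₁₁ : ¬ M x a := fun h => hx (hM _ _ h)
    rcases hall g with rfl | rfl | rfl | rfl | rfl | rfl | rfl <;> grind
  have hxa : x ≠ a := fun h => hy (h ▸ hxyb.rel₁₂)
  have hxd : x ≠ d := fun h => hx (h ▸ hade.rel₁₂)
  have hxe : x ≠ e := fun h => hx (h ▸ hade.rel₁₃)
  have h₁ := key d e hade hd.1 hd.2 hall
  have h₂ := key e d (hade.swap hM) he.1 he.2 (fun g => by have := hall g; tauto)
  have h₃ : ¬ M x a := fun h => hx (hM _ _ h)
  have h₄ := hade.exactly_one x hxa hxd hxe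
  tauto

theorem card_le_six_of_triads {L : Type*} {M : L → L → Prop}
    (hM : ∀ a b, M a b → M b a)
    (htri : ∀ a b, a ≠ b → M a b → ∃ c, IsTriad M a b c)
    (hskew : ∀ a b c, a ≠ b → a ≠ c → b ≠ c → M a b ∨ M a c ∨ M b c)
    (S : Finset L) : S.card ≤ 6 := by
  classical
  by_contra! hS
  have hbig : ∀ F : Finset L, F.card ≤ 6 → ∃ g, g ∉ F := fun F hF => by
    obtain ⟨g, -, hg⟩ := Finset.exists_mem_notMem_of_card_lt_card (hF.trans_lt hS)
    exact ⟨g, hg⟩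
  obtain ⟨a, -⟩ := hbig ∅ (by simp)
  -- the points not related to `a`
  have hnon : ∀ x y, x ≠ a → y ≠ a → x ≠ y → ¬ M a x → ¬ M a y →
      M x y ∧ ∀ w, w ≠ a → ¬ M a w → w = x ∨ w = y := by
    intro x y hxa hya hxy hx hy
    have hMxy : M x y := by have := hskew a x y hxa.symm hya.symm hxy; grind
    refine ⟨hMxy, fun w hwa hw => ?_⟩
    by_contra! hne
    obtain ⟨z, hz⟩ := htri x y hxy hMxy
    have h₁ := hskew a x w hxa.symm hwa.symm hne.1.symm
    have h₂ := hskew a y w hya.symm hwa.symm hne.2.symm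
    have h₃ := hM x w
    have h₄ := hM y w
    by_cases haz : a = z
    · exact hx (haz ▸ hM _ _ hz.rel₁₃)
    have h₅ := hz.exactly_one a hxa.symm hya.symm haz
    have h₆ : w ≠ z := by rintro rfl; grind
    have h₇ := hz.exactly_one w hne.1 hne.2 h₆
    grind
  have hnon' : ∃ x y, ∀ w, w ≠ a → ¬ M a w → w = x ∨ w = y := by
    by_contra! h
    obtain ⟨x, hxa, hx, -⟩ := h a a
    obtain ⟨y, hya, hy, hyx, -⟩ := h x x
    obtain ⟨w, hwa, hw, hwx, hwy⟩ := h x y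
    have := (hnon x y hxa hya hyx.symm hx hy).2 w hwa hw
    grind
  obtain ⟨x₀, y₀, hxy₀⟩ := hnon'
  obtain ⟨b, hba, hb⟩ : ∃ b, b ≠ a ∧ M a b := by
    by_contra! h
    obtain ⟨g, hg⟩ := hbig {a, x₀, y₀} (Finset.card_le_three.trans (by norm_num))
    simp only [Finset.mem_insert, Finset.mem_singleton, not_or] at hg
    have := h g hg.1
    have := hxy₀ g hg.1
    grind
  obtain ⟨c, habc⟩ := htri a b hba.symm hb
  obtain ⟨d, hda, hdb, hdc, hd⟩ : ∃ d, d ≠ a ∧ d ≠ b ∧ d ≠ c ∧ M a d := by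
    by_contra! h
    obtain ⟨g, hg⟩ := hbig {a, b, c, x₀, y₀} (Finset.card_le_five.trans (by norm_num))
    simp only [Finset.mem_insert, Finset.mem_singleton, not_or] at hg
    have := h g hg.1
    have := hxy₀ g hg.1
    grind
  obtain ⟨e, hade⟩ := htri a d hda.symm hd
  have hdM := habc.exactly_one d hda hdb hdc
  have hda' := hM _ _ hd
  have heb : e ≠ b := by rintro rfl; have := hade.rel₂₃; grind
  have hec : e ≠ c := by rintro rfl; have := hade.rel₂₃; grind
  have hnear : ∀ g, g ≠ a → M a g → g = b ∨ g = c ∨ g = d ∨ g = e := by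
    intro g hga hg
    by_contra! hne
    have h₁ := habc.exactly_one g hga hne.1 hne.2.1
    have h₂ := hade.exactly_one g hga hne.2.2.1 hne.2.2.2
    have h₃ := hskew g b d hne.1 hne.2.2.1 hdb.symm
    have h₄ := hM b d
    have h₅ := hM _ _ hg
    grind
  obtain ⟨x, hx⟩ := hbig {a, b, c, d, e} (Finset.card_le_five.trans (by norm_num))
  obtain ⟨y, hy⟩ := hbig {a, b, c, d, e, x} Finset.card_le_six
  simp only [Finset.mem_insert, Finset.mem_singleton, not_or] at hx hy
  have hax : ¬ M a x := fun h => by have := hnear x hx.1 h; grind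
  have hay : ¬ M a y := fun h => by have := hnear y hy.1 h; grind
  have hxy : x ≠ y := by grind
  obtain ⟨hMxy, hnon''⟩ := hnon x y hx.1 hy.1 hxy hax hay
  have hall : ∀ g, g = a ∨ g = b ∨ g = c ∨ g = d ∨ g = e ∨ g = x ∨ g = y := by
    intro g
    have h₁ := hnear g
    have h₂ := hnon'' g
    grind
  obtain ⟨z, hz⟩ := htri x y hxy hMxy
  have h₁ := hM _ _ hz.rel₁₃
  rcases hall z with rfl | rfl | rfl | rfl | rfl | rfl | rfl
  · exact hax h₁
  · exact seven_points_false hM htri habc hade hz ⟨hdb, hdc⟩ ⟨heb, hec⟩ hax hay hall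
  · exact seven_points_false hM htri (habc.swap hM) hade hz ⟨hdc, hdb⟩ ⟨hec, heb⟩ hax hay
      fun g => by have := hall g; grind
  · exact seven_points_false hM htri hade habc hz ⟨hdb.symm, heb.symm⟩ ⟨hdc.symm, hec.symm⟩
      hax hay fun g => by have := hall g; grind
  · exact seven_points_false hM htri (hade.swap hM) habc hz ⟨heb.symm, hdb.symm⟩
      ⟨hec.symm, hdc.symm⟩ hax hay fun g => by have := hall g; grind
  · exact hz.ne₁₃ rfl
  · exact hz.ne₂₃ rfl

section Trilinear

variable {k V : Type*} [Field k] [AddCommGroup V] [Module k V]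

/-- The derivative at `x` in the direction `v` of the cubic form `x ↦ N x x x`. -/
def cubicDeriv (N : V →ₗ[k] V →ₗ[k] V →ₗ[k] k) (x : V) : V →ₗ[k] k where
  toFun v := N v x x + N x v x + N x x v
  map_add' v w := by simp only [map_add, LinearMap.add_apply]; ring
  map_smul' a v := by
    simp only [map_smul, LinearMap.smul_apply, smul_eq_mul, RingHom.id_apply]; ring

theorem cubicDeriv_apply (N : V →ₗ[k] V →ₗ[k] V →ₗ[k] k) (x v : V) :
    cubicDeriv N x v = N v x x + N x v x + N x x v := rfl

/-- The full polarization of the cubic form `x ↦ N x x x`. -/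
def cubicPolar (N : V →ₗ[k] V →ₗ[k] V →ₗ[k] k) (x y z : V) : k :=
  N x y z + N x z y + N y x z + N y z x + N z x y + N z y x

/-- The plane `W` lies on the cubic `N x x x = 0`, as a scheme. -/
structure IsNullPlane (N : V →ₗ[k] V →ₗ[k] V →ₗ[k] k) (W : Submodule k V) : Prop where
  finrank_eq : Module.finrank k W = 2
  cubic_eq : ∀ v ∈ W, N v v v = 0
  deriv_eq : ∀ v ∈ W, ∀ w ∈ W, cubicDeriv N v w = 0

/-- The consequences of smoothness of the cubic surface `N x x x = 0` used for counting lines: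
no point is singular, and no plane is tangent along a line. -/
structure IsRegularCubic (N : V →ₗ[k] V →ₗ[k] V →ₗ[k] k) : Prop where
  point : ∀ p : V, p ≠ 0 → N p p p = 0 → cubicDeriv N p ≠ 0
  line : ∀ p u w : V, LinearIndependent k ![p, u, w] → N p p p = 0 → N u u u = 0 →
    cubicDeriv N p u = 0 → cubicDeriv N u p = 0 →
    ¬ (cubicDeriv N p w = 0 ∧ cubicPolar N p u w = 0 ∧ cubicDeriv N u w = 0)

theorem cubic_smul_add_smul (N : V →ₗ[k] V →ₗ[k] V →ₗ[k] k) (v w : V) (a b : k) :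
    N (a • v + b • w) (a • v + b • w) (a • v + b • w) =
      a ^ 3 * N v v v + a ^ 2 * b * cubicDeriv N v w + a * b ^ 2 * cubicDeriv N w v
        + b ^ 3 * N w w w := by
  simp only [cubicDeriv_apply, map_add, map_smul, LinearMap.add_apply, LinearMap.smul_apply,
    smul_eq_mul]
  ring

theorem cubicDeriv_smul_add_smul (N : V →ₗ[k] V →ₗ[k] V →ₗ[k] k) (v w z : V) (a b : k) :
    cubicDeriv N (a • v + b • w) z =
      a ^ 2 * cubicDeriv N v z + a * b * cubicPolar N v w z + b ^ 2 * cubicDeriv N w z := by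
  simp only [cubicDeriv_apply, cubicPolar, map_add, map_smul, LinearMap.add_apply,
    LinearMap.smul_apply, smul_eq_mul]
  ring

theorem cubic_smul_add_smul_add_smul (N : V →ₗ[k] V →ₗ[k] V →ₗ[k] k) (u v w : V) (a b c : k) :
    N (a • u + b • v + c • w) (a • u + b • v + c • w) (a • u + b • v + c • w) =
      a ^ 3 * N u u u + b ^ 3 * N v v v + c ^ 3 * N w w w
        + a ^ 2 * b * cubicDeriv N u v + a * b ^ 2 * cubicDeriv N v u
        + a ^ 2 * c * cubicDeriv N u w + a * c ^ 2 * cubicDeriv N w u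
        + b ^ 2 * c * cubicDeriv N v w + b * c ^ 2 * cubicDeriv N w v
        + a * b * c * cubicPolar N u v w := by
  simp only [cubicDeriv_apply, cubicPolar, map_add, map_smul, LinearMap.add_apply,
    LinearMap.smul_apply, smul_eq_mul]
  ring

theorem cubicDeriv_smul_add_smul_add_smul (N : V →ₗ[k] V →ₗ[k] V →ₗ[k] k) (u v w z : V)
    (a b c : k) :
    cubicDeriv N (a • u + b • v + c • w) z =
      a ^ 2 * cubicDeriv N u z + b ^ 2 * cubicDeriv N v z + c ^ 2 * cubicDeriv N w z
        + a * b * cubicPolar N u v z + a * c * cubicPolar N u w z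
        + b * c * cubicPolar N v w z := by
  simp only [cubicDeriv_apply, cubicPolar, map_add, map_smul, LinearMap.add_apply,
    LinearMap.smul_apply, smul_eq_mul]
  ring

theorem cubicPolar_right_comm (N : V →ₗ[k] V →ₗ[k] V →ₗ[k] k) (u v w : V) :
    cubicPolar N u v w = cubicPolar N u w v := by
  simp only [cubicPolar]; ring

theorem cubicPolar_rotate (N : V →ₗ[k] V →ₗ[k] V →ₗ[k] k) (u v w : V) :
    cubicPolar N u v w = cubicPolar N v w u := by
  simp only [cubicPolar]; ring

theorem cubicDeriv_self (N : V →ₗ[k] V →ₗ[k] V →ₗ[k] k) (v : V) :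
    cubicDeriv N v v = 3 * N v v v := by
  rw [cubicDeriv_apply]; ring

theorem cubicPolar_self_left (N : V →ₗ[k] V →ₗ[k] V →ₗ[k] k) (v w : V) :
    cubicPolar N v w v = 2 * cubicDeriv N v w := by
  rw [cubicDeriv_apply, cubicPolar]; ring

theorem cubicPolar_self_right (N : V →ₗ[k] V →ₗ[k] V →ₗ[k] k) (v w : V) :
    cubicPolar N v w w = 2 * cubicDeriv N w v := by
  rw [cubicDeriv_apply, cubicPolar]; ring

theorem IsNullPlane.of_span {N : V →ₗ[k] V →ₗ[k] V →ₗ[k] k} {W : Submodule k V}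
    (hW : Module.finrank k W = 2) {v w : V} (hspan : Submodule.span k {v, w} = W)
    (hv : N v v v = 0) (hw : N w w w = 0) (hvw : cubicDeriv N v w = 0)
    (hwv : cubicDeriv N w v = 0) : IsNullPlane N W := by
  subst hspan
  refine ⟨hW, fun x hx => ?_, fun x hx y hy => ?_⟩
  · obtain ⟨a, b, rfl⟩ := Submodule.mem_span_pair.1 hx
    rw [cubic_smul_add_smul, hv, hw, hvw, hwv]; ring
  · obtain ⟨a, b, rfl⟩ := Submodule.mem_span_pair.1 hx
    obtain ⟨c, d, rfl⟩ := Submodule.mem_span_pair.1 hy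
    simp only [map_add, map_smul, cubicDeriv_smul_add_smul, cubicDeriv_self,
      cubicPolar_self_left, cubicPolar_self_right, hv, hw, hvw, hwv]
    simp

theorem span_pair_eq {W : Submodule k V} (hW : Module.finrank k W = 2) {p u : V}
    (hp : p ∈ W) (hp₀ : p ≠ 0) (hu : u ∈ W) (hup : u ∉ Submodule.span k {p}) :
    Submodule.span k {p, u} = W := by
  have : FiniteDimensional k W := .of_finrank_pos (by omega)
  have hli : LinearIndependent k ![p, u] := by
    rw [LinearIndependent.pair_iff' hp₀]
    exact fun a ha => hup (Submodule.mem_span_singleton.2 ⟨a, ha⟩)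
  refine Submodule.eq_of_le_of_finrank_eq ?_ ?_
  · rw [Submodule.span_le]
    rintro x (rfl | rfl) <;> assumption
  · have h := finrank_span_eq_card hli
    rw [Matrix.range_cons_cons_empty, Fintype.card_fin] at h
    exact h.trans hW.symm

theorem exists_span_pair_of_mem {W : Submodule k V} (hW : Module.finrank k W = 2) {p : V}
    (hp : p ∈ W) (hp₀ : p ≠ 0) : ∃ u, Submodule.span k {p, u} = W := by
  have : FiniteDimensional k W := .of_finrank_pos (by omega)
  obtain ⟨u, hu, hup⟩ : ∃ u ∈ W, u ∉ Submodule.span k {p} := by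
    by_contra! h
    have := Submodule.finrank_mono (show W ≤ Submodule.span k {p} from h)
    rw [finrank_span_singleton hp₀] at this
    omega
  exact ⟨u, span_pair_eq hW hp hp₀ hu hup⟩

variable [FiniteDimensional k V]

theorem finrank_sup_of_meet {W₁ W₂ : Submodule k V} (h₁ : Module.finrank k W₁ = 2)
    (h₂ : Module.finrank k W₂ = 2) (hne : W₁ ≠ W₂) (hmeet : W₁ ⊓ W₂ ≠ ⊥) :
    Module.finrank k ↥(W₁ ⊔ W₂) = 3 := by
  have h := Submodule.finrank_sup_add_finrank_inf_eq W₁ W₂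
  have hpos : Module.finrank k ↥(W₁ ⊓ W₂) ≠ 0 := by
    rwa [Ne, Submodule.finrank_eq_zero]
  have hlt : Module.finrank k ↥(W₁ ⊓ W₂) < 2 := by
    by_contra! hle
    have e₁ := Submodule.eq_of_le_of_finrank_le (inf_le_left : W₁ ⊓ W₂ ≤ W₁) (by omega)
    have e₂ := Submodule.eq_of_le_of_finrank_le (inf_le_right : W₁ ⊓ W₂ ≤ W₂) (by omega)
    exact hne (e₁.symm.trans e₂)
  omega

theorem inf_ne_bot_of_finrank_lt {W P Q : Submodule k V} (hW : W ≤ Q) (hP : P ≤ Q)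
    (h : Module.finrank k Q < Module.finrank k W + Module.finrank k P) : W ⊓ P ≠ ⊥ := by
  intro hbot
  have h₁ := Submodule.finrank_sup_add_finrank_inf_eq W P
  have h₂ := Submodule.finrank_mono (sup_le hW hP)
  rw [hbot, finrank_bot] at h₁
  omega

/-- Three pairwise meeting lines on a smooth cubic surface are coplanar. -/
theorem IsNullPlane.le_sup {N : V →ₗ[k] V →ₗ[k] V →ₗ[k] k} (hV : Module.finrank k V = 4)
    (hN : IsRegularCubic N) {W₁ W₂ W₃ : Submodule k V} (h₁ : IsNullPlane N W₁)
    (h₂ : IsNullPlane N W₂) (h₃ : IsNullPlane N W₃) (hne : W₁ ≠ W₂)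
    (h₁₂ : W₁ ⊓ W₂ ≠ ⊥) (h₁₃ : W₁ ⊓ W₃ ≠ ⊥) (h₂₃ : W₂ ⊓ W₃ ≠ ⊥) : W₃ ≤ W₁ ⊔ W₂ := by
  by_contra hle
  obtain ⟨p, ⟨hp₁, hp₃⟩, hp⟩ := Submodule.exists_mem_ne_zero_of_ne_bot h₁₃
  obtain ⟨q, ⟨hq₂, hq₃⟩, hq⟩ := Submodule.exists_mem_ne_zero_of_ne_bot h₂₃
  by_cases hp₂ : p ∈ W₂
  · refine hN.point p hp (h₁.cubic_eq p hp₁) (LinearMap.ker_eq_top.1 ?_)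
    rw [eq_top_iff]
    have htop : W₁ ⊔ W₂ ⊔ W₃ = ⊤ := by
      have h := finrank_sup_of_meet h₁.finrank_eq h₂.finrank_eq hne h₁₂
      have hlt := Submodule.finrank_lt_finrank_of_lt (left_lt_sup.2 hle)
      have := Submodule.finrank_le (W₁ ⊔ W₂ ⊔ W₃)
      exact Submodule.eq_top_of_finrank_eq (by omega)
    rw [← htop]
    exact sup_le (sup_le (h₁.deriv_eq p hp₁) (h₂.deriv_eq p hp₂)) (h₃.deriv_eq p hp₃)
  · apply hle
    have hpq : p ∉ Submodule.span k {q} := fun h =>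
      hp₂ (Submodule.span_le.2 (Set.singleton_subset_iff.2 hq₂) h)
    have hspan := span_pair_eq h₃.finrank_eq hq₃ hq hp₃ hpq
    rw [← hspan, Submodule.span_le]
    rintro x (rfl | rfl)
    · exact Submodule.mem_sup_right hq₂
    · exact Submodule.mem_sup_left hp₁

/-- If a product `(a s + a' t) (b s + b' t) (c s + c' t)` of binary linear forms vanishes, then
one of the forms vanishes. -/
theorem eq_zero_of_prod_eq_zero {a a' b b' c c' : k} (h₀ : a * b * c = 0)
    (h₁ : a' * b * c + a * b' * c + a * b * c' = 0)
    (h₂ : a * b' * c' + a' * b * c' + a' * b' * c = 0) (h₃ : a' * b' * c' = 0) :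
    (a = 0 ∧ a' = 0) ∨ (b = 0 ∧ b' = 0) ∨ (c = 0 ∧ c' = 0) := by
  grind

/-- A smooth cubic surface meets the plane spanned by two of its intersecting lines in three
distinct lines. -/
theorem exists_third_line {N : V →ₗ[k] V →ₗ[k] V →ₗ[k] k} (hV : Module.finrank k V = 4)
    (hN : IsRegularCubic N) {W₁ W₂ : Submodule k V} (h₁ : IsNullPlane N W₁)
    (h₂ : IsNullPlane N W₂) (hne : W₁ ≠ W₂) (h₁₂ : W₁ ⊓ W₂ ≠ ⊥) :
    ∃ W₃, IsNullPlane N W₃ ∧ W₃ ≠ W₁ ∧ W₃ ≠ W₂ ∧ W₃ ≤ W₁ ⊔ W₂ ∧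
      ∀ W, IsNullPlane N W → (W ⊓ W₁ ≠ ⊥ ∨ W ⊓ W₂ ≠ ⊥ ∨ W ⊓ W₃ ≠ ⊥) ∧
        (W ≤ W₁ ⊔ W₂ → W = W₁ ∨ W = W₂ ∨ W = W₃) := by
  have hrank := finrank_sup_of_meet h₁.finrank_eq h₂.finrank_eq hne h₁₂
  obtain ⟨p, ⟨hp₁, hp₂⟩, hp⟩ := Submodule.exists_mem_ne_zero_of_ne_bot h₁₂
  obtain ⟨u, hu⟩ := exists_span_pair_of_mem h₁.finrank_eq hp₁ hp
  obtain ⟨w, hw⟩ := exists_span_pair_of_mem h₂.finrank_eq hp₂ hp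
  have hu₁ : u ∈ W₁ := hu ▸ Submodule.mem_span_of_mem (by simp)
  have hw₂ : w ∈ W₂ := hw ▸ Submodule.mem_span_of_mem (by simp)
  have hspan : Submodule.span k (Set.range ![p, u, w]) = W₁ ⊔ W₂ := by
    rw [← hu, ← hw, ← Submodule.span_union]
    congr 1
    ext x
    simp [Matrix.range_cons]
    tauto
  have hli : LinearIndependent k ![p, u, w] := by
    rw [linearIndependent_iff_card_eq_finrank_span, Set.finrank, hspan, hrank, Fintype.card_fin]
  have hli' : LinearIndependent k ![p, w, u] := by
    convert hli.comp (Equiv.swap 1 2) (Equiv.injective _) using 1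
    ext i
    fin_cases i <;> rfl
  have hpp := h₁.cubic_eq p hp₁
  have huu := h₁.cubic_eq u hu₁
  have hww := h₂.cubic_eq w hw₂
  have hpu := h₁.deriv_eq p hp₁ u hu₁
  have hup := h₁.deriv_eq u hu₁ p hp₁
  have hpw := h₂.deriv_eq p hp₂ w hw₂
  have hwp := h₂.deriv_eq w hw₂ p hp₂
  have hab := hN.line p u w hli hpp huu hpu hup
  have hac := hN.line p w u hli' hpp hww hpw hwp
  obtain ⟨Φ, hΦ⟩ : ∃ Φ : (Fin 3 → k) →ₗ[k] V,
      Φ = Fintype.linearCombination k ![p, u, w] := ⟨_, rfl⟩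
  have hinj : Function.Injective Φ := 
    hΦ ▸ linearIndependent_iff_injective_fintypeLinearCombination.1 hli
  have hrange : LinearMap.range Φ = W₁ ⊔ W₂ := by
    rw [hΦ, Fintype.range_linearCombination, hspan]
  have hΦa : ∀ x, Φ x = x 0 • p + x 1 • u + x 2 • w := fun x => by
    rw [hΦ, Fintype.linearCombination_apply, Fin.sum_univ_three]; rfl
  obtain ⟨l, hl⟩ : ∃ l : (Fin 3 → k) →ₗ[k] k, ∀ x, l x = cubicPolar N p u w * x 0 +
      cubicDeriv N u w * x 1 + cubicDeriv N w u * x 2 :=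
    ⟨cubicPolar N p u w • LinearMap.proj 0 + cubicDeriv N u w • LinearMap.proj 1 +
      cubicDeriv N w u • LinearMap.proj 2, fun x => rfl⟩
  have hcubic : ∀ x, N (Φ x) (Φ x) (Φ x) = x 1 * x 2 * l x := fun x => by
    rw [hΦa, hl, cubic_smul_add_smul_add_smul, hpp, huu, hww, hpu, hup, hpw, hwp]
    ring
  have hderiv : ∀ x y, cubicDeriv N (Φ x) (Φ y) =
      y 1 * x 2 * l x + x 1 * y 2 * l x + x 1 * x 2 * l y := fun x y => by
    rw [hΦa, hΦa, hl, hl, map_add, map_add, map_smul, map_smul, map_smul]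
    simp only [cubicDeriv_smul_add_smul_add_smul, cubicPolar_self_left, cubicPolar_self_right,
      cubicDeriv_self, hpp, huu, hww, hpu, hup, hpw, hwp, ← cubicPolar_right_comm N p u w,
      ← cubicPolar_rotate N p u w, smul_eq_mul]
    ring
  -- membership in the three lines in terms of coordinates
  have hmem₁ : ∀ x, x 2 = 0 → Φ x ∈ W₁ := fun x hx => by
    rw [hΦa, hx, zero_smul, add_zero]
    exact W₁.add_mem (W₁.smul_mem _ hp₁) (W₁.smul_mem _ hu₁)
  have hmem₂ : ∀ x, x 1 = 0 → Φ x ∈ W₂ := fun x hx => by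
    rw [hΦa, hx, zero_smul, add_zero]
    exact W₂.add_mem (W₂.smul_mem _ hp₂) (W₂.smul_mem _ hw₂)
  have hmem₃ : ∀ x, l x = 0 ↔ Φ x ∈ (LinearMap.ker l).map Φ := fun x =>
    ⟨fun h => ⟨x, h, rfl⟩, fun ⟨y, hy, e⟩ => hinj e ▸ hy⟩
  have he₀ : Φ ![1, 0, 0] = p := by rw [hΦa]; simp
  have he₁ : Φ ![0, 1, 0] = u := by rw [hΦa]; simp
  have he₂ : Φ ![0, 0, 1] = w := by rw [hΦa]; simp
  have hne₁ : ∀ h : p ∈ (LinearMap.ker l).map Φ, u ∉ (LinearMap.ker l).map Φ := fun hp hu => by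
    rw [← he₀, ← hmem₃, hl] at hp
    rw [← he₁, ← hmem₃, hl] at hu
    simp at hp hu
    exact hab ⟨hpw, hp, hu⟩
  have hne₂ : ∀ h : p ∈ (LinearMap.ker l).map Φ, w ∉ (LinearMap.ker l).map Φ := fun hp hw => by
    rw [← he₀, ← hmem₃, hl] at hp
    rw [← he₂, ← hmem₃, hl] at hw
    simp at hp hw
    exact hac ⟨hpu, by rwa [cubicPolar_right_comm], hw⟩
  have hle₃ : (LinearMap.ker l).map Φ ≤ W₁ ⊔ W₂ := hrange ▸ LinearMap.map_le_range
  have hl₀ : l ≠ 0 := by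
    rintro rfl
    exact hne₁ (he₀ ▸ (hmem₃ _).1 rfl) (he₁ ▸ (hmem₃ _).1 rfl)
  have hrank₃ : Module.finrank k ((LinearMap.ker l).map Φ) = 2 := by
    rw [← (Submodule.equivMapOfInjective Φ hinj _).finrank_eq]
    have := Module.Dual.finrank_ker_add_one_of_ne_zero hl₀
    rw [Module.finrank_fin_fun] at this
    omega
  refine ⟨(LinearMap.ker l).map Φ, ⟨hrank₃, ?_, ?_⟩, ?_, ?_, hle₃, fun W hW => ⟨?_, fun hle => ?_⟩⟩
  · rintro _ ⟨x, hx, rfl⟩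
    rw [hcubic, LinearMap.mem_ker.1 hx, mul_zero]
  · rintro _ ⟨x, hx, rfl⟩ _ ⟨y, hy, rfl⟩
    rw [hderiv, LinearMap.mem_ker.1 hx, LinearMap.mem_ker.1 hy]
    ring
  · exact fun h => hne₁ (h ▸ hp₁) (h ▸ hu₁)
  · exact fun h => hne₂ (h ▸ hp₂) (h ▸ hw₂)
  · have hmeet : W ⊓ (W₁ ⊔ W₂) ≠ ⊥ := by
      refine inf_ne_bot_of_finrank_lt le_top le_top ?_
      rw [finrank_top, hV, hW.finrank_eq, hrank]
      norm_num
    obtain ⟨v, ⟨hv, hv'⟩, hv₀⟩ := Submodule.exists_mem_ne_zero_of_ne_bot hmeet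
    obtain ⟨x, rfl⟩ : v ∈ LinearMap.range Φ := hrange ▸ hv'
    have h := hW.cubic_eq _ hv
    rw [hcubic, mul_eq_zero, mul_eq_zero] at h
    have hinf : ∀ W', Φ x ∈ W' → W ⊓ W' ≠ ⊥ := fun W' hx =>
      Submodule.ne_bot_iff _ |>.2 ⟨Φ x, ⟨hv, hx⟩, hv₀⟩
    rcases h with (h | h) | h
    · exact .inr (.inl (hinf _ (hmem₂ x h)))
    · exact .inl (hinf _ (hmem₁ x h))
    · exact .inr (.inr (hinf _ ((hmem₃ x).1 h)))
  · have hW₀ : W ≠ ⊥ := by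
      rintro rfl
      simpa using hW.finrank_eq
    obtain ⟨v, hv, hv₀⟩ := Submodule.exists_mem_ne_zero_of_ne_bot hW₀
    obtain ⟨v', hvv'⟩ := exists_span_pair_of_mem hW.finrank_eq hv hv₀
    have hv' : v' ∈ W := hvv' ▸ Submodule.mem_span_of_mem (by simp)
    obtain ⟨x, rfl⟩ : v ∈ LinearMap.range Φ := hrange ▸ hle hv
    obtain ⟨y, rfl⟩ : v' ∈ LinearMap.range Φ := hrange ▸ hle hv'
    have heq : ∀ W' : Submodule k V, Module.finrank k W' = 2 → Φ x ∈ W' → Φ y ∈ W' → W = W' := by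
      intro W' hW' hx hy
      refine Submodule.eq_of_le_of_finrank_eq ?_ (hW.finrank_eq.trans hW'.symm)
      rw [← hvv', Submodule.span_le]
      rintro z (rfl | rfl) <;> assumption
    have h₀ := hW.cubic_eq _ hv
    have h₁' := hW.deriv_eq _ hv _ hv'
    have h₂' := hW.deriv_eq _ hv' _ hv
    have h₃ := hW.cubic_eq _ hv'
    rw [hcubic] at h₀ h₃
    rw [hderiv] at h₁' h₂'
    rcases eq_zero_of_prod_eq_zero h₀ h₁' (by linear_combination h₂') h₃ with h | h | h
    · exact .inr (.inl (heq _ h₂.finrank_eq (hmem₂ x h.1) (hmem₂ y h.2)))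
    · exact .inl (heq _ h₁.finrank_eq (hmem₁ x h.1) (hmem₁ y h.2))
    · exact .inr (.inr (heq _ hrank₃ ((hmem₃ x).1 h.1) ((hmem₃ y).1 h.2)))

theorem exists_isTriad {N : V →ₗ[k] V →ₗ[k] V →ₗ[k] k} (hV : Module.finrank k V = 4)
    (hN : IsRegularCubic N) {W₁ W₂ : Submodule k V} (h₁ : IsNullPlane N W₁)
    (h₂ : IsNullPlane N W₂) (hne : (⟨W₁, h₁⟩ : {W // IsNullPlane N W}) ≠ ⟨W₂, h₂⟩)
    (h₁₂ : W₁ ⊓ W₂ ≠ ⊥) :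
    ∃ W₃, IsTriad (fun W W' : {W // IsNullPlane N W} => W.1 ⊓ W'.1 ≠ ⊥)
      ⟨W₁, h₁⟩ ⟨W₂, h₂⟩ W₃ := by
  have hne' : W₁ ≠ W₂ := fun h => hne (Subtype.ext h)
  obtain ⟨W₃, h₃, hne₁, hne₂, hle, hall⟩ := exists_third_line hV hN h₁ h₂ hne' h₁₂
  have hrank := finrank_sup_of_meet h₁.finrank_eq h₂.finrank_eq hne' h₁₂
  have h₁₃ : W₁ ⊓ W₃ ≠ ⊥ := inf_ne_bot_of_finrank_lt le_sup_left hle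
    (by rw [hrank, h₁.finrank_eq, h₃.finrank_eq]; norm_num)
  have h₂₃ : W₂ ⊓ W₃ ≠ ⊥ := inf_ne_bot_of_finrank_lt le_sup_right hle
    (by rw [hrank, h₂.finrank_eq, h₃.finrank_eq]; norm_num)
  refine ⟨⟨W₃, h₃⟩, hne, fun h => hne₁ (congrArg Subtype.val h).symm,
    fun h => hne₂ (congrArg Subtype.val h).symm, h₁₂, h₁₃, h₂₃, ?_⟩
  rintro ⟨W, hW⟩ hW₁ hW₂ hW₃
  obtain ⟨hmeet, hplane⟩ := hall W hW
  have hnle : ¬ W ≤ W₁ ⊔ W₂ := fun h => by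
    rcases hplane h with rfl | rfl | rfl <;> contradiction
  have hnot : ∀ {A B : Submodule k V}, IsNullPlane N A → IsNullPlane N B → A ≠ B →
      A ⊓ B ≠ ⊥ → A ≤ W₁ ⊔ W₂ → B ≤ W₁ ⊔ W₂ → ¬ (W ⊓ A ≠ ⊥ ∧ W ⊓ B ≠ ⊥) := by
    rintro A B hA hB hAB hm hAle hBle ⟨hWA, hWB⟩
    rw [inf_comm] at hWA hWB
    exact hnle ((hA.le_sup hV hN hB hW hAB hm hWA hWB).trans (sup_le hAle hBle))
  have h₄ := hnot h₁ h₂ hne' h₁₂ le_sup_left le_sup_right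
  have h₅ := hnot h₁ h₃ hne₁.symm h₁₃ le_sup_left hle
  have h₆ := hnot h₂ h₃ hne₂.symm h₂₃ le_sup_right hle
  grind

end Trilinear

section Coordinates

variable {k : Type*} [Field k]

/-- The trilinear form on `K⁴` with coefficients `c`. -/
noncomputable def triForm (c : Fin 4 → Fin 4 → Fin 4 → k) :
    (Fin 4 → k) →ₗ[k] (Fin 4 → k) →ₗ[k] (Fin 4 → k) →ₗ[k] k :=
  ∑ i, ∑ j, ∑ l, c i j l • (LinearMap.proj i : (Fin 4 → k) →ₗ[k] k).smulRight
    ((LinearMap.proj j : (Fin 4 → k) →ₗ[k] k).smulRight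
      (LinearMap.proj l : (Fin 4 → k) →ₗ[k] k))

theorem triForm_apply (c : Fin 4 → Fin 4 → Fin 4 → k) (x y z : Fin 4 → k) :
    triForm c x y z = ∑ i, ∑ j, ∑ l, c i j l * (x i * y j * z l) := by
  simp [triForm, LinearMap.sum_apply, mul_assoc]

theorem triForm_map {K : Type*} [Field K] (φ : k →+* K) (c : Fin 4 → Fin 4 → Fin 4 → k)
    (x y z : Fin 4 → k) :
    triForm (fun i j l => φ (c i j l)) (φ ∘ x) (φ ∘ y) (φ ∘ z) = φ (triForm c x y z) := by
  simp [triForm_apply]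

theorem cubicDeriv_triForm_map {K : Type*} [Field K] (φ : k →+* K)
    (c : Fin 4 → Fin 4 → Fin 4 → k) (x y : Fin 4 → k) :
    cubicDeriv (triForm fun i j l => φ (c i j l)) (φ ∘ x) (φ ∘ y) =
      φ (cubicDeriv (triForm c) x y) := by
  simp only [cubicDeriv_apply, triForm_map, map_add]

theorem cubicPolar_triForm_map {K : Type*} [Field K] (φ : k →+* K)
    (c : Fin 4 → Fin 4 → Fin 4 → k) (x y z : Fin 4 → k) :
    cubicPolar (triForm fun i j l => φ (c i j l)) (φ ∘ x) (φ ∘ y) (φ ∘ z) =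
      φ (cubicPolar (triForm c) x y z) := by
  simp only [cubicPolar, triForm_map, map_add]

/-- The cubic polynomial with (redundant) coefficients `c`. -/
noncomputable def cubicPoly (c : Fin 4 → Fin 4 → Fin 4 → k) : MvPolynomial (Fin 4) k :=
  ∑ i, ∑ j, ∑ l, C (c i j l) * (X i * X j * X l)

open scoped Pointwise in
theorem exists_eq_cubicPoly {f : MvPolynomial (Fin 4) k} (hf : f.IsHomogeneous 3) :
    ∃ c, f = cubicPoly c := by
  have hmem : f ∈ Submodule.span k (Set.range (X : Fin 4 → MvPolynomial (Fin 4) k) *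
      Set.range X * Set.range X) := by
    rw [← mem_homogeneousSubmodule, ← homogeneousSubmodule_one_pow,
      homogeneousSubmodule_one_eq_span_X, pow_succ, pow_two, Submodule.span_mul_span,
      Submodule.span_mul_span] at hf
    exact hf
  clear hf
  induction hmem using Submodule.span_induction with
  | mem g hg =>
    obtain ⟨_, ⟨_, ⟨i, rfl⟩, _, ⟨j, rfl⟩, rfl⟩, _, ⟨l, rfl⟩, rfl⟩ := hg
    refine ⟨fun i' j' l' => if i' = i then if j' = j then if l' = l then 1 else 0 else 0 else 0, ?_⟩
    simp [cubicPoly, apply_ite (C (σ := Fin 4) (R := k)), ite_mul, Finset.sum_ite_irrel]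
  | zero => exact ⟨0, by simp [cubicPoly]⟩
  | add g h _ _ hg hh =>
    obtain ⟨c, rfl⟩ := hg
    obtain ⟨d, rfl⟩ := hh
    exact ⟨c + d, by simp [cubicPoly, add_mul, Finset.sum_add_distrib]⟩
  | smul a g _ hg =>
    obtain ⟨c, rfl⟩ := hg
    exact ⟨a • c, by simp [cubicPoly, smul_eq_C_mul, Finset.mul_sum, mul_assoc]⟩

theorem eval_map_cubicPoly {K : Type*} [Field K] (φ : k →+* K)
    (c : Fin 4 → Fin 4 → Fin 4 → k) (x : Fin 4 → K) :
    eval x (map φ (cubicPoly c)) = triForm (fun i j l => φ (c i j l)) x x x := by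
  simp [cubicPoly, triForm_apply]

theorem eval_map_pderiv_cubicPoly {K : Type*} [Field K] (φ : k →+* K)
    (c : Fin 4 → Fin 4 → Fin 4 → k) (x : Fin 4 → K) (m : Fin 4) :
    eval x (map φ (pderiv m (cubicPoly c))) =
      cubicDeriv (triForm fun i j l => φ (c i j l)) x (φ ∘ Pi.single m 1) := by
  have hX : ∀ i : Fin 4, eval x (map φ (pderiv m (X i))) = 
      φ ((Pi.single m 1 : Fin 4 → k) i) := fun i => by
    rw [pderiv_X]
    by_cases h : i = m
    · simp [h]
    · simp [h]
  simp only [cubicPoly, map_sum, Derivation.leibniz, pderiv_C, smul_eq_mul, mul_zero, add_zero,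
    map_add, map_mul, hX, cubicDeriv_apply, triForm_apply, ← Finset.sum_add_distrib, map_C, map_X,
    eval_C, eval_X, Function.comp_apply]
  refine Finset.sum_congr rfl fun i _ => Finset.sum_congr rfl fun j _ =>
    Finset.sum_congr rfl fun l _ => ?_
  ring

theorem lineRestrict_cubicPoly (c : Fin 4 → Fin 4 → Fin 4 → k) (v w : Fin 4 → k) :
    lineRestrict (cubicPoly c) v w =
      C (triForm c v v v) * X 0 ^ 3 + C (cubicDeriv (triForm c) v w) * (X 0 ^ 2 * X 1) +
        C (cubicDeriv (triForm c) w v) * (X 0 * X 1 ^ 2) + C (triForm c w w w) * X 1 ^ 3 := by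
  simp only [lineRestrict, cubicPoly, map_sum, map_mul, map_add, cubicDeriv_apply, triForm_apply,
    aeval_X, algHom_C, algebraMap_eq, Finset.sum_mul, ← Finset.sum_add_distrib]
  refine Finset.sum_congr rfl fun i _ => Finset.sum_congr rfl fun j _ =>
    Finset.sum_congr rfl fun l _ => ?_
  ring

theorem binary_cubic_eq_zero_iff (a b c d : k) :
    (C a * X 0 ^ 3 + C b * (X 0 ^ 2 * X 1) + C c * (X 0 * X 1 ^ 2) + C d * X 1 ^ 3 :
      MvPolynomial (Fin 2) k) = 0 ↔ a = 0 ∧ b = 0 ∧ c = 0 ∧ d = 0 := by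
  refine ⟨fun h => ⟨?_, ?_, ?_, ?_⟩, ?_⟩
  · simpa using congrArg (eval ![1, 0]) h
  · simpa using congrArg (fun g => eval ![1, 0] (pderiv 1 g)) h
  · simpa using congrArg (fun g => eval ![0, 1] (pderiv 0 g)) h
  · simpa using congrArg (eval ![0, 1]) h
  · rintro ⟨rfl, rfl, rfl, rfl⟩
    simp

theorem isLineOn_iff_isNullPlane (c : Fin 4 → Fin 4 → Fin 4 → k)
    (W : Submodule k (Fin 4 → k)) : IsLineOn (cubicPoly c) W ↔ IsNullPlane (triForm c) W := by
  simp only [IsLineOn, lineRestrict_cubicPoly, binary_cubic_eq_zero_iff]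
  constructor
  · rintro ⟨hrank, v, w, hspan, hv, hvw, hwv, hw⟩
    exact .of_span hrank hspan hv hw hvw hwv
  · intro hW
    have hW₀ : W ≠ ⊥ := by
      rintro rfl
      simpa using hW.finrank_eq
    obtain ⟨v, hv, hv₀⟩ := Submodule.exists_mem_ne_zero_of_ne_bot hW₀
    obtain ⟨w, hspan⟩ := exists_span_pair_of_mem hW.finrank_eq hv hv₀
    have hw : w ∈ W := hspan ▸ Submodule.mem_span_of_mem (by simp)
    exact ⟨hW.finrank_eq, v, w, hspan, hW.cubic_eq v hv, hW.deriv_eq v hv w hw,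
      hW.deriv_eq w hw v hv, hW.cubic_eq w hw⟩

theorem exists_binary_quadratic_zero {K : Type*} [Field K] [IsAlgClosed K] (a b c : K) :
    ∃ s t : K, (s ≠ 0 ∨ t ≠ 0) ∧ s ^ 2 * a + s * t * b + t ^ 2 * c = 0 := by
  by_cases ha : a = 0
  · exact ⟨1, 0, by simp [ha]⟩
  · obtain ⟨s, hs⟩ := IsAlgClosed.exists_root
      (Polynomial.C a * Polynomial.X ^ 2 + Polynomial.C b * Polynomial.X + Polynomial.C c)
      (by rw [Polynomial.degree_quadratic ha]; norm_num)
    refine ⟨s, 1, by simp, ?_⟩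
    simp only [Polynomial.IsRoot.def, Polynomial.eval_add, Polynomial.eval_mul,
      Polynomial.eval_C, Polynomial.eval_pow, Polynomial.eval_X] at hs
    linear_combination hs

/-- Linearly independent vectors stay independent after extension of the base field. -/
theorem smul_add_smul_ne_zero {K ι : Type*} [Field K] (φ : k →+* K) {p u : ι → k}
    (hli : LinearIndependent k ![p, u]) {s t : K} (hst : s ≠ 0 ∨ t ≠ 0) :
    s • (φ ∘ p) + t • (φ ∘ u) ≠ 0 := by
  intro h
  have hi : ∀ i, s * φ (p i) + t * φ (u i) = 0 := fun i => congrFun h i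
  have hminor : ∀ i j, p i * u j = p j * u i := fun i j => by
    apply φ.injective
    rw [map_mul, map_mul]
    rcases hst with hs | ht
    · apply mul_left_cancel₀ hs
      linear_combination φ (u j) * hi i - φ (u i) * hi j
    · apply mul_left_cancel₀ ht
      linear_combination φ (p i) * hi j - φ (p j) * hi i
  rw [LinearIndependent.pair_iff] at hli
  have hu : u = 0 := by
    funext j
    refine (hli (u j) (-p j) ?_).1
    funext i
    simp only [Pi.add_apply, Pi.smul_apply, smul_eq_mul, Pi.zero_apply]
    linear_combination hminor i j
  simpa using (hli 0 1 (by simp [hu])).2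

theorem isRegularCubic_triForm {c : Fin 4 → Fin 4 → Fin 4 → k}
    (hf : IsSmoothCubic k (cubicPoly c)) : IsRegularCubic (triForm c) := by
  obtain ⟨φ, hφ⟩ : ∃ φ, φ = algebraMap k (AlgebraicClosure k) := ⟨_, rfl⟩
  have hsm : ∀ x : Fin 4 → AlgebraicClosure k, triForm (fun i j l => φ (c i j l)) x x x = 0 →
      (∀ v : Fin 4 → k, cubicDeriv (triForm fun i j l => φ (c i j l)) x (φ ∘ v) = 0) → x = 0 := by
    intro x hx hd
    refine hf.2.2 x ⟨?_, fun m => ?_⟩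
    · rw [eval_map_cubicPoly, ← hφ, hx]
    · rw [eval_map_pderiv_cubicPoly, ← hφ, hd]
  refine ⟨fun p hp hpp hd => hp ?_, fun p u w hli hpp huu hpu hup ⟨hpw, hpuw, huw⟩ => ?_⟩
  · have h := hsm (φ ∘ p) (by rw [triForm_map, hpp, map_zero]) fun v => by
      rw [cubicDeriv_triForm_map, hd, LinearMap.zero_apply, map_zero]
    funext i
    exact φ.injective ((congrFun h i).trans (map_zero φ).symm)
  · obtain ⟨q, hq⟩ : ∃ q, q ∉ Submodule.span k (Set.range ![p, u, w]) := by
      by_contra! h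
      have h₁ := finrank_span_eq_card hli
      rw [Submodule.eq_top_iff'.2 h, finrank_top, Module.finrank_fin_fun] at h₁
      simp at h₁
    have hspan : Submodule.span k (Set.range ![p, u, w]) ⊔ Submodule.span k {q} = ⊤ := by
      apply Submodule.eq_top_of_finrank_eq
      have h₁ := finrank_span_eq_card hli
      have h₂ := Submodule.finrank_lt_finrank_of_lt
        (left_lt_sup.2 fun h : Submodule.span k {q} ≤ _ =>
          hq (h (Submodule.mem_span_singleton_self q)))
      have h₃ := Submodule.finrank_le
        (Submodule.span k (Set.range ![p, u, w]) ⊔ Submodule.span k {q})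
      rw [h₁, Fintype.card_fin] at h₂
      rw [Module.finrank_fin_fun] at h₃ ⊢
      omega
    obtain ⟨N, hN⟩ : ∃ N, N = triForm fun i j l => φ (c i j l) := ⟨_, rfl⟩
    rw [← hN] at hsm
    have hderiv : ∀ x y, cubicDeriv N (φ ∘ x) (φ ∘ y) = φ (cubicDeriv (triForm c) x y) :=
      hN ▸ cubicDeriv_triForm_map φ c
    have hpolar : ∀ x y z, cubicPolar N (φ ∘ x) (φ ∘ y) (φ ∘ z) =
        φ (cubicPolar (triForm c) x y z) := hN ▸ cubicPolar_triForm_map φ c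
    have hcub : ∀ x, N (φ ∘ x) (φ ∘ x) (φ ∘ x) = φ (triForm c x x x) :=
      fun x => hN ▸ triForm_map φ c x x x
    obtain ⟨s, t, hst, hroot⟩ := exists_binary_quadratic_zero
      (φ (cubicDeriv (triForm c) p q)) (φ (cubicPolar (triForm c) p u q))
      (φ (cubicDeriv (triForm c) u q))
    have hli₂ : LinearIndependent k ![p, u] := by
      have hcomp : ![p, u] = ![p, u, w] ∘ (Fin.castSucc : Fin 2 → Fin 3) :=
        funext fun i => by fin_cases i <;> rfl
      exact hcomp ▸ hli.comp _ (Fin.castSucc_injective 2)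
    refine smul_add_smul_ne_zero φ hli₂ hst (hsm _ ?_ fun v => ?_)
    · rw [cubic_smul_add_smul, hcub, hcub, hderiv, hderiv, hpp, huu, hpu, hup]
      simp
    · -- the functional vanishes on a spanning set
      have hv : v ∈ Submodule.span k (Set.range ![p, u, w]) ⊔ Submodule.span k {q} :=
        hspan ▸ Submodule.mem_top
      rw [← Submodule.span_union] at hv
      induction hv using Submodule.span_induction with
      | mem v hv =>
        rw [cubicDeriv_smul_add_smul, hderiv, hderiv, hpolar]
        rcases hv with ⟨i, rfl⟩ | rfl
        · fin_cases i <;>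
            simp [cubicDeriv_self, cubicPolar_self_left, cubicPolar_self_right, *]
        · exact hroot
      | zero => rw [show φ ∘ (0 : Fin 4 → k) = 0 from funext fun _ => map_zero φ, map_zero]
      | add v v' _ _ hv hv' =>
        rw [show φ ∘ (v + v') = φ ∘ v + φ ∘ v' from funext fun _ => map_add φ _ _, map_add, hv,
          hv', add_zero]
      | smul a v _ hv =>
        rw [show φ ∘ (a • v) = φ a • (φ ∘ v) from funext fun _ => map_mul φ _ _, map_smul, hv,
          smul_zero]

end Coordinates

/-- a smooth cubic surface over a field `k` with no skew triple of
`k`-lines contains at most six `k`-lines. -/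
theorem at_most_six_lines_no_skew_triple {k : Type*} [Field k]
    (f : MvPolynomial (Fin 4) k) (hf : IsSmoothCubic k f)
    (hskew : ∀ W₁ W₂ W₃ : Submodule k (Fin 4 → k),
      IsLineOn f W₁ → IsLineOn f W₂ → IsLineOn f W₃ →
      W₁ ≠ W₂ → W₁ ≠ W₃ → W₂ ≠ W₃ →
      W₁ ⊓ W₂ ≠ ⊥ ∨ W₁ ⊓ W₃ ≠ ⊥ ∨ W₂ ⊓ W₃ ≠ ⊥) :
    ∀ S : Finset (Submodule k (Fin 4 → k)), (∀ W ∈ S, IsLineOn f W) → S.card ≤ 6 := by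
  intro S hS
  obtain ⟨c, rfl⟩ := exists_eq_cubicPoly hf.2.1
  have hN := isRegularCubic_triForm hf
  have hV : Module.finrank k (Fin 4 → k) = 4 := Module.finrank_fin_fun k
  simp only [isLineOn_iff_isNullPlane] at hS hskew
  have hcard := card_le_six_of_triads
    (L := {W : Submodule k (Fin 4 → k) // IsNullPlane (triForm c) W})
    (M := fun W₁ W₂ => W₁.1 ⊓ W₂.1 ≠ ⊥) (fun W₁ W₂ h => by rwa [inf_comm]) ?_
    (fun W₁ W₂ W₃ h₁₂ h₁₃ h₂₃ => hskew W₁ W₂ W₃ W₁.2 W₂.2 W₃.2 (Subtype.coe_ne_coe.2 h₁₂)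
      (Subtype.coe_ne_coe.2 h₁₃) (Subtype.coe_ne_coe.2 h₂₃))
    (S.attach.map ⟨fun W => ⟨W.1, hS W.1 W.2⟩, fun W W' h => Subtype.ext (congrArg (·.1) h)⟩)
  · rwa [Finset.card_map, Finset.card_attach] at hcard
  · rintro ⟨W₁, h₁⟩ ⟨W₂, h₂⟩ hne h₁₂
    exact exists_isTriad hV hN h₁ h₂ hne h₁₂
end
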